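/- arXiv:2407.16720 — 2 statements merged into one kernel-verified Lean document; each statement's English description precedes it below -/
import Mathlib

section
/- Let μ₊, μ₋, c_{v,+}, c_{v,−} > 0 and γ₊, γ₋ > 1 be constants, and let α₊, α₋, ρ₊, ρ₋, θ₊, θ₋, u : [0,T] × ℝ → ℝ be continuously differentiable functions with α₊ + α₋ = 1, α_± > 0, ρ_± > 0, θ_± > 0, satisfying pointwise the averaged two-phase system: ∂ₜα_± + u∂ₓα_± = (α₊α₋/(α₋μ₊ + α₊μ₋))(σ_∓ − σ_±); ∂ₜ(α_±ρ_±) + ∂ₓ(α_±ρ_±u) = 0; ∂ₜ(α_±ρ_±e_±) + ∂ₓ(α_±ρ_±e_±u) = (α₊α₋/(α₋μ₊ + α₊μ₋))σ(σ_∓ − σ_±) + α_±σ∂ₓu, where e_± = c_{v,±}θ_±, p_± = (γ_± − 1)ρ_±θ_±, σ_± = μ_±∂ₓu − p_±, and σ = [(α₊/μ₊)σ₊ + (α₋/μ₋)σ₋]/(α₊/μ₊ + α₋/μ₋). Then the specific entropies s_± = c_{v,±}·ln(θ_±) − (γ_± − 1)·ln(ρ_±) satisfy pointwise: α_±ρ_±θ_±·D_t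 s_± = (α_∓μ_±α₊α₋/(α₋μ₊ + α₊μ₋)²)(σ_∓ − σ_±)² + (2α₊α₋/(α₋μ₊ + α₊μ₋))(σ_∓ − σ_±)μ_±∂ₓu + α_±μ_±(∂ₓu)², where D_t f = ∂ₜf + u∂ₓf. -/
open Set Function

/-- Partial derivative in time of a function of `(t, x)`. -/
noncomputable def pdt (f : ℝ → ℝ → ℝ) (t x : ℝ) : ℝ := deriv (fun s => f s x) t

/-- Partial derivative in space of a function of `(t, x)`. -/
noncomputable def pdx (f : ℝ → ℝ → ℝ) (t x : ℝ) : ℝ := deriv (fun y => f t y) x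

/-- Phasic Cauchy stress `σ_± = μ_± ∂ₓu − (γ_± − 1) ρ_± θ_±`. -/
noncomputable def sigP (μ γ : ℝ) (r th u : ℝ → ℝ → ℝ) (t x : ℝ) : ℝ :=
  μ * pdx u t x - (γ - 1) * r t x * th t x

/-- Homogenized Cauchy stress `σ = [(α₊/μ₊)σ₊ + (α₋/μ₋)σ₋]/(α₊/μ₊ + α₋/μ₋)`. -/
noncomputable def sigBar (μp μm ap am sp sm : ℝ) : ℝ :=
  ((ap / μp) * sp + (am / μm) * sm) / (ap / μp + am / μm)

/-- Specific entropy `s_± = c_{v,±} ln θ_± − (γ_± − 1) ln ρ_±`. -/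
noncomputable def entr (k γ : ℝ) (r th : ℝ → ℝ → ℝ) (t x : ℝ) : ℝ :=
  k * Real.log (th t x) - (γ - 1) * Real.log (r t x)

theorem hasT {f : ℝ → ℝ → ℝ} (hf : ContDiff ℝ 1 (uncurry f)) (t x : ℝ) :
    HasDerivAt (fun s => f s x) (pdt f t x) t := by
  have h1 : Differentiable ℝ (uncurry f) := hf.differentiable (by norm_num)
  have h2 : Differentiable ℝ (fun s : ℝ => uncurry f (s, x)) :=
    h1.comp (by fun_prop : Differentiable ℝ (fun s : ℝ => (s, x)))
  exact (h2 t).hasDerivAt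

theorem hasX {f : ℝ → ℝ → ℝ} (hf : ContDiff ℝ 1 (uncurry f)) (t x : ℝ) :
    HasDerivAt (fun y => f t y) (pdx f t x) x := by
  have h1 : Differentiable ℝ (uncurry f) := hf.differentiable (by norm_num)
  have h2 : Differentiable ℝ (fun s : ℝ => uncurry f (t, s)) :=
    h1.comp (by fun_prop : Differentiable ℝ (fun s : ℝ => (t, s)))
  exact (h2 x).hasDerivAt

theorem phase (k γ t x X S : ℝ) (a r th u : ℝ → ℝ → ℝ)
    (ha : ContDiff ℝ 1 (uncurry a)) (hr : ContDiff ℝ 1 (uncurry r))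
    (hth : ContDiff ℝ 1 (uncurry th)) (hu : ContDiff ℝ 1 (uncurry u))
    (hr0 : 0 < r t x) (hth0 : 0 < th t x)
    (hX : pdt a t x + u t x * pdx a t x = X)
    (hm : pdt (fun s y => a s y * r s y) t x
        + pdx (fun s y => a s y * r s y * u s y) t x = 0)
    (he : pdt (fun s y => a s y * r s y * (k * th s y)) t x
        + pdx (fun s y => a s y * r s y * (k * th s y) * u s y) t x
        = S * (X + a t x * pdx u t x)) :
    a t x * r t x * th t x * (pdt (entr k γ r th) t x + u t x * pdx (entr k γ r th) t x)
      = (S + (γ - 1) * r t x * th t x) * (X + a t x * pdx u t x) := by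
  have e1 : pdt (fun s y => a s y * r s y) t x = _ := ((hasT ha t x).mul (hasT hr t x)).deriv
  have e2 : pdx (fun s y => a s y * r s y * u s y) t x = _ :=
    (((hasX ha t x).mul (hasX hr t x)).mul (hasX hu t x)).deriv
  have e3 : pdt (fun s y => a s y * r s y * (k * th s y)) t x = _ :=
    (((hasT ha t x).mul (hasT hr t x)).mul ((hasT hth t x).const_mul k)).deriv
  have e4 : pdx (fun s y => a s y * r s y * (k * th s y) * u s y) t x = _ :=
    ((((hasX ha t x).mul (hasX hr t x)).mul ((hasX hth t x).const_mul k)).mul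
      (hasX hu t x)).deriv
  have e5 : pdt (entr k γ r th) t x = _ :=
    ((((hasT hth t x).log hth0.ne').const_mul k).sub
      (((hasT hr t x).log hr0.ne').const_mul (γ - 1))).deriv
  have e6 : pdx (entr k γ r th) t x = _ :=
    ((((hasX hth t x).log hth0.ne').const_mul k).sub
      (((hasX hr t x).log hr0.ne').const_mul (γ - 1))).deriv
  rw [e1, e2] at hm
  rw [e3, e4] at he
  rw [e5, e6]
  simp only [Pi.mul_apply] at hm he
  have hl : a t x * r t x * th t x * (k * (pdt th t x / th t x) - (γ - 1) * (pdt r t x / r t x)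
      + u t x * (k * (pdx th t x / th t x) - (γ - 1) * (pdx r t x / r t x)))
      = a t x * r t x * k * (pdt th t x + u t x * pdx th t x)
        - (γ - 1) * a t x * th t x * (pdt r t x + u t x * pdx r t x) := by
    field_simp
    ring
  rw [hl]
  subst hX
  linear_combination he - (k * th t x + (γ - 1) * th t x) * hm

/-- For `C¹` solutions of the averaged two-phase system, the specific
entropies `s_± = c_{v,±} ln θ_± − (γ_±−1) ln ρ_±` satisfy pointwise the stated identity
for the material derivative `D_t s_± = ∂ₜ s_± + u ∂ₓ s_±` (both signs). -/
theorem stmt1 (T μp μm γp γm kp km : ℝ)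
    (hT : 0 < T) (hμp : 0 < μp) (hμm : 0 < μm) (hγp : 1 < γp) (hγm : 1 < γm)
    (hkp : 0 < kp) (hkm : 0 < km)
    (ap am rp rm thp thm u : ℝ → ℝ → ℝ)
    (hap : ContDiff ℝ 1 (uncurry ap)) (ham : ContDiff ℝ 1 (uncurry am))
    (hrp : ContDiff ℝ 1 (uncurry rp)) (hrm : ContDiff ℝ 1 (uncurry rm))
    (hthp : ContDiff ℝ 1 (uncurry thp)) (hthm : ContDiff ℝ 1 (uncurry thm))
    (hu : ContDiff ℝ 1 (uncurry u))
    (hsum : ∀ t ∈ Icc (0:ℝ) T, ∀ x : ℝ, ap t x + am t x = 1)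
    (hpos : ∀ t ∈ Icc (0:ℝ) T, ∀ x : ℝ,
      0 < ap t x ∧ 0 < am t x ∧ 0 < rp t x ∧ 0 < rm t x ∧ 0 < thp t x ∧ 0 < thm t x)
    -- evolution of the volume fractions
    (heqap : ∀ t ∈ Icc (0:ℝ) T, ∀ x : ℝ,
      pdt ap t x + u t x * pdx ap t x
        = ap t x * am t x / (am t x * μp + ap t x * μm)
            * (sigP μm γm rm thm u t x - sigP μp γp rp thp u t x))
    (heqam : ∀ t ∈ Icc (0:ℝ) T, ∀ x : ℝ,
      pdt am t x + u t x * pdx am t x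
        = ap t x * am t x / (am t x * μp + ap t x * μm)
            * (sigP μp γp rp thp u t x - sigP μm γm rm thm u t x))
    -- phasic mass equations
    (hmassp : ∀ t ∈ Icc (0:ℝ) T, ∀ x : ℝ,
      pdt (fun s y => ap s y * rp s y) t x
        + pdx (fun s y => ap s y * rp s y * u s y) t x = 0)
    (hmassm : ∀ t ∈ Icc (0:ℝ) T, ∀ x : ℝ,
      pdt (fun s y => am s y * rm s y) t x
        + pdx (fun s y => am s y * rm s y * u s y) t x = 0)
    -- phasic internal energy equations, with e_± = c_{v,±} θ_±
    (henergyp : ∀ t ∈ Icc (0:ℝ) T, ∀ x : ℝ,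
      pdt (fun s y => ap s y * rp s y * (kp * thp s y)) t x
        + pdx (fun s y => ap s y * rp s y * (kp * thp s y) * u s y) t x
        = ap t x * am t x / (am t x * μp + ap t x * μm)
            * sigBar μp μm (ap t x) (am t x)
                (sigP μp γp rp thp u t x) (sigP μm γm rm thm u t x)
            * (sigP μm γm rm thm u t x - sigP μp γp rp thp u t x)
          + ap t x
            * sigBar μp μm (ap t x) (am t x)
                (sigP μp γp rp thp u t x) (sigP μm γm rm thm u t x)
            * pdx u t x)
    (henergym : ∀ t ∈ Icc (0:ℝ) T, ∀ x : ℝ,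
      pdt (fun s y => am s y * rm s y * (km * thm s y)) t x
        + pdx (fun s y => am s y * rm s y * (km * thm s y) * u s y) t x
        = ap t x * am t x / (am t x * μp + ap t x * μm)
            * sigBar μp μm (ap t x) (am t x)
                (sigP μp γp rp thp u t x) (sigP μm γm rm thm u t x)
            * (sigP μp γp rp thp u t x - sigP μm γm rm thm u t x)
          + am t x
            * sigBar μp μm (ap t x) (am t x)
                (sigP μp γp rp thp u t x) (sigP μm γm rm thm u t x)
            * pdx u t x) :
    ∀ t ∈ Icc (0:ℝ) T, ∀ x : ℝ,
      (ap t x * rp t x * thp t x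
          * (pdt (entr kp γp rp thp) t x + u t x * pdx (entr kp γp rp thp) t x)
        = am t x * μp * (ap t x * am t x) / (am t x * μp + ap t x * μm) ^ 2
            * (sigP μm γm rm thm u t x - sigP μp γp rp thp u t x) ^ 2
          + 2 * (ap t x * am t x) / (am t x * μp + ap t x * μm)
            * (sigP μm γm rm thm u t x - sigP μp γp rp thp u t x) * μp * pdx u t x
          + ap t x * μp * (pdx u t x) ^ 2)
      ∧
      (am t x * rm t x * thm t x
          * (pdt (entr km γm rm thm) t x + u t x * pdx (entr km γm rm thm) t x)
        = ap t x * μm * (ap t x * am t x) / (am t x * μp + ap t x * μm) ^ 2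
            * (sigP μp γp rp thp u t x - sigP μm γm rm thm u t x) ^ 2
          + 2 * (ap t x * am t x) / (am t x * μp + ap t x * μm)
            * (sigP μp γp rp thp u t x - sigP μm γm rm thm u t x) * μm * pdx u t x
          + am t x * μm * (pdx u t x) ^ 2) := by
  intro t ht x
  obtain ⟨h1, h2, h3, h4, h5, h6⟩ := hpos t ht x
  have hD : am t x * μp + ap t x * μm ≠ 0 := by positivity
  have hE : ap t x / μp + am t x / μm ≠ 0 := by positivity
  constructor
  · rw [phase kp γp t x _ (sigBar μp μm (ap t x) (am t x)
      (sigP μp γp rp thp u t x) (sigP μm γm rm thm u t x)) ap rp thp u hap hrp hthp hu h3 h5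
      (heqap t ht x) (hmassp t ht x) (by rw [henergyp t ht x]; ring)]
    have hS : sigBar μp μm (ap t x) (am t x)
        (sigP μp γp rp thp u t x) (sigP μm γm rm thm u t x) + (γp - 1) * rp t x * thp t x
        = μp * pdx u t x + am t x * μp / (am t x * μp + ap t x * μm)
          * (sigP μm γm rm thm u t x - sigP μp γp rp thp u t x) := by
      have : (γp - 1) * rp t x * thp t x = μp * pdx u t x - sigP μp γp rp thp u t x := by
        unfold sigP; ring
      rw [this, sigBar]
      have hE' : ap t x / μp + am t x / μm = (am t x * μp + ap t x * μm) / (μp * μm) := by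
        field_simp; ring
      rw [hE']
      field_simp
      ring
    rw [hS]
    field_simp
    ring
  · rw [phase km γm t x _ (sigBar μp μm (ap t x) (am t x)
      (sigP μp γp rp thp u t x) (sigP μm γm rm thm u t x)) am rm thm u ham hrm hthm hu h4 h6
      (heqam t ht x) (hmassm t ht x) (by rw [henergym t ht x]; ring)]
    have hS : sigBar μp μm (ap t x) (am t x)
        (sigP μp γp rp thp u t x) (sigP μm γm rm thm u t x) + (γm - 1) * rm t x * thm t x
        = μm * pdx u t x + ap t x * μm / (am t x * μp + ap t x * μm)
          * (sigP μp γp rp thp u t x - sigP μm γm rm thm u t x) := by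
      have : (γm - 1) * rm t x * thm t x = μm * pdx u t x - sigP μm γm rm thm u t x := by
        unfold sigP; ring
      rw [this, sigBar]
      have hE' : ap t x / μp + am t x / μm = (am t x * μp + ap t x * μm) / (μp * μm) := by
        field_simp; ring
      rw [hE']
      field_simp
      ring
    rw [hS]
    field_simp
    ring
end

section
/- Let (c, ρ, θ, u) be a smooth classical solution of the mesoscopic two-phase Navier–Stokes system on [0,T], spatially 1-periodic, with 0 ≤ c ≤ 1, 0 < ρ ≤ ρ̄ and θ > 0, and let σ = μ(c)∂ₓu − (γ(c)−1)ρθ. Then there exists a constant C₅ > 0, depending only on μ_±, γ_±, c_{v,±}, ρ̄, T, the initial total mass ∫₀¹ρ(0,x)dx, the initial total energy ∫₀¹(ρE)(0,x)dx, and ∫₀¹σ(0,x)² dx, such that for every t ∈ [0,T]: ∫₀¹ σ(t,x)² dx + ∫₀ᵗ ∫₀¹ (∂ₓσ(s,x))² dx ds ≤ C₅. In particular σ is bounded in L^∞(0,T; L²) ∩ L²(0,T; H¹), and ∫₀ᵀ ‖σ(t,·)‖_{L^∞(0,1)}² dt is bounded by a constant C₆ of the same dependencies. -/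
open Set Function MeasureTheory intervalIntegral

/-- Affine interpolation of a coefficient between the two phases:
`aff a b c = c·a + (1−c)·b` (so `μ(c) = aff μ₊ μ₋ c`, etc.). -/
def affc (a b s : ℝ) : ℝ := s * a + (1 - s) * b

/-- Cauchy stress `σ = μ(c)∂ₓu − (γ(c)−1)ρθ` of the mesoscopic two-phase model. -/
noncomputable def sigm (μp μm γp γm : ℝ) (c ρ θ u : ℝ → ℝ → ℝ) (t x : ℝ) : ℝ :=
  affc μp μm (c t x) * pdx u t x - (affc γp γm (c t x) - 1) * ρ t x * θ t x

/-- Specific total energy `E = u²/2 + c_v(c)θ`. -/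
noncomputable def Etot (kp km : ℝ) (c θ u : ℝ → ℝ → ℝ) (t x : ℝ) : ℝ :=
  u t x ^ 2 / 2 + affc kp km (c t x) * θ t x

/-- Admissible constants: `μ_± > 0`, `γ_± > 1`, `c_{v,±} > 0`. -/
def GoodConsts (μp μm γp γm kp km : ℝ) : Prop :=
  0 < μp ∧ 0 < μm ∧ 1 < γp ∧ 1 < γm ∧ 0 < kp ∧ 0 < km

/-- The mesoscopic two-phase Navier–Stokes system on the one-dimensional torus:
spatial 1-periodicity together with the transport, mass, momentum and total
energy equations, satisfied pointwise on `[0,T] × ℝ`. -/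
def MesoEqns (μp μm γp γm kp km T : ℝ) (c ρ θ u : ℝ → ℝ → ℝ) : Prop :=
  (∀ t x : ℝ, c t (x + 1) = c t x) ∧ (∀ t x : ℝ, ρ t (x + 1) = ρ t x) ∧
  (∀ t x : ℝ, θ t (x + 1) = θ t x) ∧ (∀ t x : ℝ, u t (x + 1) = u t x) ∧
  (∀ t ∈ Icc (0:ℝ) T, ∀ x : ℝ, pdt c t x + u t x * pdx c t x = 0) ∧
  (∀ t ∈ Icc (0:ℝ) T, ∀ x : ℝ,
    pdt ρ t x + pdx (fun s y => ρ s y * u s y) t x = 0) ∧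
  (∀ t ∈ Icc (0:ℝ) T, ∀ x : ℝ,
    pdt (fun s y => ρ s y * u s y) t x + pdx (fun s y => ρ s y * u s y ^ 2) t x
      = pdx (sigm μp μm γp γm c ρ θ u) t x) ∧
  (∀ t ∈ Icc (0:ℝ) T, ∀ x : ℝ,
    pdt (fun s y => ρ s y * Etot kp km c θ u s y) t x
      + pdx (fun s y => ρ s y * Etot kp km c θ u s y * u s y) t x
      = pdx (fun s y => sigm μp μm γp γm c ρ θ u s y * u s y) t x)

lemma nse_pdt {f : ℝ → ℝ → ℝ} {t x : ℝ} (hf : DifferentiableAt ℝ (uncurry f) (t, x)) :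
    HasDerivAt (fun s => f s x) (fderiv ℝ (uncurry f) (t, x) (1, 0)) t := by
  have h1 : HasDerivAt (fun s : ℝ => (s, x)) ((1 : ℝ), (0 : ℝ)) t :=
    (hasDerivAt_id t).prodMk (hasDerivAt_const t x)
  exact hf.hasFDerivAt.comp_hasDerivAt t h1

lemma nse_pdx {f : ℝ → ℝ → ℝ} {t x : ℝ} (hf : DifferentiableAt ℝ (uncurry f) (t, x)) :
    HasDerivAt (fun y => f t y) (fderiv ℝ (uncurry f) (t, x) (0, 1)) x := by
  have h1 : HasDerivAt (fun s : ℝ => (t, s)) ((0 : ℝ), (1 : ℝ)) x :=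
    (hasDerivAt_const x t).prodMk (hasDerivAt_id x)
  exact hf.hasFDerivAt.comp_hasDerivAt x h1

lemma nse_pdt_eq {f : ℝ → ℝ → ℝ} {t x : ℝ} (hf : DifferentiableAt ℝ (uncurry f) (t, x)) :
    pdt f t x = fderiv ℝ (uncurry f) (t, x) (1, 0) := (nse_pdt hf).deriv

lemma nse_pdx_eq {f : ℝ → ℝ → ℝ} {t x : ℝ} (hf : DifferentiableAt ℝ (uncurry f) (t, x)) :
    pdx f t x = fderiv ℝ (uncurry f) (t, x) (0, 1) := (nse_pdx hf).deriv

lemma nse_hdt {f : ℝ → ℝ → ℝ} {t x : ℝ} (hf : ContDiffAt ℝ 1 (uncurry f) (t, x)) :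
    HasDerivAt (fun s => f s x) (pdt f t x) t := by
  have := hf.differentiableAt (by simp)
  rw [nse_pdt_eq this]; exact nse_pdt this

lemma nse_hdx {f : ℝ → ℝ → ℝ} {t x : ℝ} (hf : ContDiffAt ℝ 1 (uncurry f) (t, x)) :
    HasDerivAt (fun s => f t s) (pdx f t x) x := by
  have := hf.differentiableAt (by simp)
  rw [nse_pdx_eq this]; exact nse_pdx this

lemma nse_smooth_pdt {f : ℝ → ℝ → ℝ} (hf : ContDiff ℝ (⊤ : ℕ∞) (uncurry f)) :
    ContDiff ℝ (⊤ : ℕ∞) (uncurry (pdt f)) := by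
  have : uncurry (pdt f) = fun z => fderiv ℝ (uncurry f) z (1, 0) := by
    ext ⟨t, x⟩
    exact nse_pdt_eq (hf.differentiable (by simp) _)
  rw [this]
  exact (hf.fderiv_right (m := (⊤ : ℕ∞)) (by norm_cast)).clm_apply contDiff_const

lemma nse_smooth_pdx {f : ℝ → ℝ → ℝ} (hf : ContDiff ℝ (⊤ : ℕ∞) (uncurry f)) :
    ContDiff ℝ (⊤ : ℕ∞) (uncurry (pdx f)) := by
  have : uncurry (pdx f) = fun z => fderiv ℝ (uncurry f) z (0, 1) := by
    ext ⟨t, x⟩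
    exact nse_pdx_eq (hf.differentiable (by simp) _)
  rw [this]
  exact (hf.fderiv_right (m := (⊤ : ℕ∞)) (by norm_cast)).clm_apply contDiff_const

lemma nse_comm {f : ℝ → ℝ → ℝ} (hf : ContDiff ℝ (⊤ : ℕ∞) (uncurry f)) (t x : ℝ) :
    pdt (pdx f) t x = pdx (pdt f) t x := by
  have hd : ∀ z, DifferentiableAt ℝ (uncurry f) z := fun z => hf.differentiable (by simp) z
  have hd2 : DifferentiableAt ℝ (fderiv ℝ (uncurry f)) (t, x) :=
    (hf.fderiv_right (m := (⊤ : ℕ∞)) (by norm_cast)).differentiable (by simp) _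
  have e1 : uncurry (pdx f) = fun z => fderiv ℝ (uncurry f) z (0, 1) := by
    ext ⟨t, x⟩; exact nse_pdx_eq (hd _)
  have e2 : uncurry (pdt f) = fun z => fderiv ℝ (uncurry f) z (1, 0) := by
    ext ⟨t, x⟩; exact nse_pdt_eq (hd _)
  rw [nse_pdt_eq ((nse_smooth_pdx hf).differentiable (by simp) _),
    nse_pdx_eq ((nse_smooth_pdt hf).differentiable (by simp) _), e1, e2]
  have hs : IsSymmSndFDerivAt ℝ (uncurry f) (t, x) :=
    hf.contDiffAt.isSymmSndFDerivAt (by simp only [minSmoothness_of_isRCLikeNormedField]; exact WithTop.coe_le_coe.2 (le_top : (2 : ℕ∞) ≤ ⊤))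
  have k1 := (hd2.hasFDerivAt.clm_apply (hasFDerivAt_const ((0:ℝ), (1:ℝ)) (t, x))).fderiv
  have k2 := (hd2.hasFDerivAt.clm_apply (hasFDerivAt_const ((1:ℝ), (0:ℝ)) (t, x))).fderiv
  rw [k1, k2]
  simp only [add_apply, ContinuousLinearMap.comp_apply,
    ContinuousLinearMap.flip_apply, zero_apply, map_zero, zero_add]
  exact hs _ _

lemma nse_contOn_fderiv {f : ℝ → ℝ → ℝ} {S : Set (ℝ × ℝ)}
    (hf : ∀ z ∈ S, ContDiffAt ℝ 1 (uncurry f) z) (v : ℝ × ℝ) :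
    ContinuousOn (fun z => fderiv ℝ (uncurry f) z v) S := by
  intro z hz
  have h1 : ContinuousAt (fderiv ℝ (uncurry f)) z :=
    ((hf z hz).fderiv_right (m := 0) (by simp)).continuousAt
  exact (h1.clm_apply continuousAt_const).continuousWithinAt

lemma nse_contOn_pdt {f : ℝ → ℝ → ℝ} {S : Set (ℝ × ℝ)}
    (hf : ∀ z ∈ S, ContDiffAt ℝ 1 (uncurry f) z) : ContinuousOn (uncurry (pdt f)) S := by
  refine (nse_contOn_fderiv hf (1, 0)).congr ?_
  rintro ⟨t, x⟩ hz
  exact nse_pdt_eq ((hf _ hz).differentiableAt (by simp))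

lemma nse_contOn_pdx {f : ℝ → ℝ → ℝ} {S : Set (ℝ × ℝ)}
    (hf : ∀ z ∈ S, ContDiffAt ℝ 1 (uncurry f) z) : ContinuousOn (uncurry (pdx f)) S := by
  refine (nse_contOn_fderiv hf (0, 1)).congr ?_
  rintro ⟨t, x⟩ hz
  exact nse_pdx_eq ((hf _ hz).differentiableAt (by simp))

lemma nse_proj_cont {T : ℝ} (hT : 0 ≤ T) {h : ℝ → ℝ → ℝ}
    (hh : ContinuousOn (uncurry h) (Icc 0 T ×ˢ univ)) :
    Continuous (uncurry fun s x => h (projIcc 0 T hT s : ℝ) x) := by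
  have : Continuous (fun z : ℝ × ℝ => ((projIcc 0 T hT z.1 : ℝ), z.2)) := by
    refine Continuous.prodMk ?_ continuous_snd
    exact continuous_subtype_val.comp (continuous_projIcc.comp continuous_fst)
  refine hh.comp_continuous this ?_
  intro z
  exact ⟨(projIcc 0 T hT z.1).2, mem_univ _⟩

lemma nse_param_contOn {T : ℝ} (hT : 0 ≤ T) {h : ℝ → ℝ → ℝ}
    (hh : ContinuousOn (uncurry h) (Icc 0 T ×ˢ univ)) :
    ContinuousOn (fun s => ∫ x in (0:ℝ)..1, h s x) (Icc 0 T) := by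
  have := intervalIntegral.continuous_parametric_intervalIntegral_of_continuous'
    (μ := volume) (nse_proj_cont hT hh) 0 1
  refine this.continuousOn.congr ?_
  intro s hs
  simp only [projIcc_of_mem hT hs]

lemma nse_slice {T : ℝ} {h : ℝ → ℝ → ℝ}
    (hh : ContinuousOn (uncurry h) (Icc 0 T ×ˢ univ)) {t : ℝ} (ht : t ∈ Icc 0 T) :
    Continuous (h t) :=
  hh.comp_continuous (f := fun x : ℝ => (t, x)) (by fun_prop) (fun x => ⟨ht, mem_univ _⟩)

lemma nse_swap {h : ℝ → ℝ → ℝ} (hh : Continuous (uncurry h)) {t : ℝ} (ht : 0 ≤ t) :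
    (∫ x in (0:ℝ)..1, ∫ s in (0:ℝ)..t, h s x) = ∫ s in (0:ℝ)..t, ∫ x in (0:ℝ)..1, h s x := by
  simp only [intervalIntegral.integral_of_le ht, intervalIntegral.integral_of_le zero_le_one]
  refine integral_integral_swap (f := fun x s => h s x) ?_
  rw [Measure.prod_restrict]
  have : Continuous (uncurry fun x s => h s x) := hh.comp continuous_swap
  refine (this.continuousOn.integrableOn_compact
    (isCompact_Icc.prod isCompact_Icc)).mono_set (t := Icc (0:ℝ) 1 ×ˢ Icc (0:ℝ) t) ?_
  exact prod_mono Ioc_subset_Icc_self Ioc_subset_Icc_self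

lemma nse_balance {T : ℝ} (hT : 0 ≤ T) {f F g : ℝ → ℝ → ℝ}
    (hf : ∀ t ∈ Icc (0:ℝ) T, ∀ x, ContDiffAt ℝ 1 (uncurry f) (t, x))
    (hF : ∀ t ∈ Icc (0:ℝ) T, ∀ x, ContDiffAt ℝ 1 (uncurry F) (t, x))
    (hper : ∀ t ∈ Icc (0:ℝ) T, F t 1 = F t 0)
    (heq : ∀ t ∈ Icc (0:ℝ) T, ∀ x, pdt f t x + pdx F t x = g t x) :
    ∀ t ∈ Icc (0:ℝ) T, (∫ x in (0:ℝ)..1, f t x) =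
      (∫ x in (0:ℝ)..1, f 0 x) + ∫ s in (0:ℝ)..t, ∫ x in (0:ℝ)..1, g s x := by
  intro t ht
  have hf' : ∀ z ∈ Icc (0:ℝ) T ×ˢ (univ : Set ℝ), ContDiffAt ℝ 1 (uncurry f) z :=
    fun z hz => hf z.1 hz.1 z.2
  have hF' : ∀ z ∈ Icc (0:ℝ) T ×ˢ (univ : Set ℝ), ContDiffAt ℝ 1 (uncurry F) z :=
    fun z hz => hF z.1 hz.1 z.2
  have c1 := nse_contOn_pdt hf'
  have c2 := nse_contOn_pdx hF'
  have c0 : ContinuousOn (uncurry f) (Icc (0:ℝ) T ×ˢ univ) :=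
    fun z hz => (hf' z hz).continuousAt.continuousWithinAt
  have h0 : (0:ℝ) ∈ Icc (0:ℝ) T := ⟨le_rfl, hT⟩
  have hsub : ∀ s ∈ uIcc (0:ℝ) t, s ∈ Icc (0:ℝ) T := by
    intro s hs
    rw [uIcc_of_le ht.1] at hs
    exact ⟨hs.1, hs.2.trans ht.2⟩
  have e1 : ∀ s ∈ Icc (0:ℝ) T, (∫ x in (0:ℝ)..1, g s x) = ∫ x in (0:ℝ)..1, pdt f s x := by
    intro s hs
    have e2 : (∫ x in (0:ℝ)..1, pdx F s x) = 0 := by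
      rw [intervalIntegral.integral_eq_sub_of_hasDerivAt (f := F s)
        (fun x _ => nse_hdx (hF s hs x)) ((nse_slice c2 hs).intervalIntegrable _ _),
        hper s hs, sub_self]
    have e3 : (∫ x in (0:ℝ)..1, g s x) = ∫ x in (0:ℝ)..1, (pdt f s x + pdx F s x) := by
      simp only [heq s hs]
    rw [e3, intervalIntegral.integral_add ((nse_slice c1 hs).intervalIntegrable _ _)
      ((nse_slice c2 hs).intervalIntegrable _ _), e2, add_zero]
  have e4 : (∫ s in (0:ℝ)..t, ∫ x in (0:ℝ)..1, g s x)
      = ∫ s in (0:ℝ)..t, ∫ x in (0:ℝ)..1, pdt f (projIcc 0 T hT s : ℝ) x := by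
    refine intervalIntegral.integral_congr ?_
    intro s hs
    have := hsub s hs
    simp only [e1 s this, projIcc_of_mem hT this]
  have e5 : ∀ x, (∫ s in (0:ℝ)..t, pdt f (projIcc 0 T hT s : ℝ) x) = f t x - f 0 x := by
    intro x
    have : (∫ s in (0:ℝ)..t, pdt f (projIcc 0 T hT s : ℝ) x) = ∫ s in (0:ℝ)..t, pdt f s x := by
      refine intervalIntegral.integral_congr ?_
      intro s hs
      simp only [projIcc_of_mem hT (hsub s hs)]
    rw [this, intervalIntegral.integral_eq_sub_of_hasDerivAt (f := fun s => f s x)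
        (fun s hs => nse_hdt (hf s (hsub s hs) x))]
    refine ContinuousOn.intervalIntegrable ?_
    exact c1.comp (f := fun s : ℝ => (s, x)) (by fun_prop) (fun s hs => ⟨hsub s hs, mem_univ _⟩)
  rw [e4, ← nse_swap (nse_proj_cont hT c1) ht.1]
  simp only [e5]
  rw [intervalIntegral.integral_sub ((nse_slice c0 ht).intervalIntegrable _ _)
      ((nse_slice c0 h0).intervalIntegrable _ _)]
  ring

lemma nse_cs {f g : ℝ → ℝ} (hf : Continuous f) (hg : Continuous g) :
    (∫ x in (0:ℝ)..1, f x * g x) ^ 2 ≤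
      (∫ x in (0:ℝ)..1, f x ^ 2) * ∫ x in (0:ℝ)..1, g x ^ 2 := by
  have key : ∀ l : ℝ, 0 ≤ (∫ x in (0:ℝ)..1, f x ^ 2) * (l * l)
      + (2 * ∫ x in (0:ℝ)..1, f x * g x) * l + ∫ x in (0:ℝ)..1, g x ^ 2 := by
    intro l
    have h1 : (0:ℝ) ≤ ∫ x in (0:ℝ)..1, (l * f x + g x) ^ 2 :=
      intervalIntegral.integral_nonneg zero_le_one (fun x _ => sq_nonneg _)
    have h2 : (∫ x in (0:ℝ)..1, (l * f x + g x) ^ 2)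
        = ∫ x in (0:ℝ)..1, ((l * l) * f x ^ 2 + (2 * l) * (f x * g x) + g x ^ 2) := by
      congr 1; ext x; ring
    rw [h2, intervalIntegral.integral_add
      (Continuous.intervalIntegrable (by fun_prop) _ _)
      (Continuous.intervalIntegrable (by fun_prop) _ _), intervalIntegral.integral_add
      (Continuous.intervalIntegrable (by fun_prop) _ _)
      (Continuous.intervalIntegrable (by fun_prop) _ _),
      intervalIntegral.integral_const_mul, intervalIntegral.integral_const_mul] at h1
    linarith
  have := discrim_le_zero key
  unfold discrim at this
  nlinarith

lemma nse_sup {f f' : ℝ → ℝ} (hf : ∀ x, HasDerivAt f (f' x) x) (hf' : Continuous f')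
    {x : ℝ} (hx : x ∈ Icc (0:ℝ) 1) :
    f x ^ 2 ≤ (∫ y in (0:ℝ)..1, f y ^ 2) + 2 * ∫ y in (0:ℝ)..1, |f y| * |f' y| := by
  have cf : Continuous f := continuous_iff_continuousAt.2 fun x => (hf x).continuousAt
  have hd : ∀ x, HasDerivAt (fun y => f y ^ 2) (2 * f x * f' x) x := by
    intro x
    have := (hf x).fun_pow 2
    simpa using this
  have key : ∀ y ∈ Icc (0:ℝ) 1, f x ^ 2 ≤ f y ^ 2 + 2 * ∫ y in (0:ℝ)..1, |f y| * |f' y| := by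
    intro y hy
    have h1 : (∫ z in y..x, 2 * f z * f' z) = f x ^ 2 - f y ^ 2 :=
      intervalIntegral.integral_eq_sub_of_hasDerivAt (fun z _ => hd z)
        (Continuous.intervalIntegrable (by fun_prop) _ _)
    have h2 : |∫ z in y..x, 2 * f z * f' z| ≤ ∫ z in (0:ℝ)..1, |2 * f z * f' z| := by
      have ha := intervalIntegral.norm_integral_le_integral_norm_uIoc
        (f := fun z => 2 * f z * f' z) (a := y) (b := x) (μ := volume)
      simp only [Real.norm_eq_abs] at ha
      refine ha.trans ?_
      rw [intervalIntegral.integral_of_le zero_le_one]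
      refine setIntegral_mono_set ?_ ?_ ?_
      · exact (Continuous.integrableOn_Icc (by fun_prop)).mono_set Ioc_subset_Icc_self
      · exact Filter.Eventually.of_forall fun z => abs_nonneg _
      · refine LE.le.eventuallyLE ?_
        intro z hz
        rw [mem_uIoc] at hz
        rcases hz with hz | hz
        · exact ⟨lt_of_le_of_lt hy.1 hz.1, hz.2.trans hx.2⟩
        · exact ⟨lt_of_le_of_lt hx.1 hz.1, hz.2.trans hy.2⟩
    have h3 : (∫ z in (0:ℝ)..1, |2 * f z * f' z|) = 2 * ∫ y in (0:ℝ)..1, |f y| * |f' y| := by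
      rw [← intervalIntegral.integral_const_mul]
      congr 1; ext z
      rw [abs_mul, abs_mul, abs_two]; ring
    have := le_abs_self (∫ z in y..x, 2 * f z * f' z)
    linarith
  have h4 : (∫ y in (0:ℝ)..1, f x ^ 2) ≤
      ∫ y in (0:ℝ)..1, (f y ^ 2 + 2 * ∫ y in (0:ℝ)..1, |f y| * |f' y|) :=
    intervalIntegral.integral_mono_on zero_le_one
      (Continuous.intervalIntegrable (by fun_prop) _ _)
      (Continuous.intervalIntegrable (by fun_prop) _ _) key
  rw [intervalIntegral.integral_add (Continuous.intervalIntegrable (by fun_prop) _ _)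
      (Continuous.intervalIntegrable (by fun_prop) _ _)] at h4
  simpa using h4

structure NseSol (μp μm γp γm kp km T ρbar : ℝ) (c ρ θ u : ℝ → ℝ → ℝ) : Prop where
  hconst : GoodConsts μp μm γp γm kp km
  hT : 0 < T
  hc : ContDiff ℝ (⊤ : ℕ∞) (uncurry c)
  hr : ContDiff ℝ (⊤ : ℕ∞) (uncurry ρ)
  hth : ContDiff ℝ (⊤ : ℕ∞) (uncurry θ)
  hu : ContDiff ℝ (⊤ : ℕ∞) (uncurry u)
  hpos : ∀ t ∈ Icc (0:ℝ) T, ∀ x : ℝ,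
        c t x ∈ Icc (0:ℝ) 1 ∧ 0 < ρ t x ∧ ρ t x ≤ ρbar ∧ 0 < θ t x
  heq : MesoEqns μp μm γp γm kp km T c ρ θ u

lemma nse_c1 {f : ℝ → ℝ → ℝ} (hf : ContDiff ℝ (⊤ : ℕ∞) (uncurry f)) (z : ℝ × ℝ) :
    ContDiffAt ℝ 1 (uncurry f) z :=
  hf.contDiffAt.of_le (by exact_mod_cast le_top)

lemma nse_affc_hd {a b y g' : ℝ} {g : ℝ → ℝ} (h : HasDerivAt g g' y) :
    HasDerivAt (fun y => affc a b (g y)) ((a - b) * g') y := by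
  unfold affc
  exact ((h.mul_const a).fun_add ((h.const_sub 1).mul_const b)).congr_deriv (by ring)

lemma nse_affc_pos {a b s : ℝ} (hs : s ∈ Icc (0:ℝ) 1) :
    min a b ≤ affc a b s ∧ affc a b s ≤ max a b := by
  unfold affc
  have h1 := min_le_left a b
  have h2 := min_le_right a b
  have h3 := le_max_left a b
  have h4 := le_max_right a b
  obtain ⟨h5, h6⟩ := hs
  constructor <;> nlinarith

namespace NseSol

variable {μp μm γp γm kp km T ρbar : ℝ} {c ρ θ u : ℝ → ℝ → ℝ}

lemma mu_pos (S : NseSol μp μm γp γm kp km T ρbar c ρ θ u) {t : ℝ} (ht : t ∈ Icc 0 T) (x : ℝ) :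
    0 < affc μp μm (c t x) :=
  lt_of_lt_of_le (lt_min S.hconst.1 S.hconst.2.1)
    (nse_affc_pos (S.hpos t ht x).1).1

lemma ga_pos (S : NseSol μp μm γp γm kp km T ρbar c ρ θ u) {t : ℝ} (ht : t ∈ Icc 0 T) (x : ℝ) :
    1 < affc γp γm (c t x) :=
  lt_of_lt_of_le (lt_min S.hconst.2.2.1 S.hconst.2.2.2.1)
    (nse_affc_pos (S.hpos t ht x).1).1

lemma k_pos (S : NseSol μp μm γp γm kp km T ρbar c ρ θ u) {t : ℝ} (ht : t ∈ Icc 0 T) (x : ℝ) :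
    0 < affc kp km (c t x) :=
  lt_of_lt_of_le (lt_min S.hconst.2.2.2.2.1 S.hconst.2.2.2.2.2)
    (nse_affc_pos (S.hpos t ht x).1).1

lemma smooth_sigm (S : NseSol μp μm γp γm kp km T ρbar c ρ θ u) :
    ContDiff ℝ (⊤ : ℕ∞) (uncurry (sigm μp μm γp γm c ρ θ u)) := by
  have h1 := S.hc
  have h2 := S.hr
  have h3 := S.hth
  have h4 := nse_smooth_pdx S.hu
  have : ContDiff ℝ (⊤ : ℕ∞) (fun z : ℝ × ℝ => affc μp μm (uncurry c z) * uncurry (pdx u) z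
      - (affc γp γm (uncurry c z) - 1) * uncurry ρ z * uncurry θ z) := by
    unfold affc
    fun_prop
  exact this

lemma mass (S : NseSol μp μm γp γm kp km T ρbar c ρ θ u) {t : ℝ} (ht : t ∈ Icc 0 T) (x : ℝ) :
    pdt ρ t x + pdx ρ t x * u t x + ρ t x * pdx u t x = 0 := by
  obtain ⟨-, -, -, -, -, h, -, -⟩ := S.heq
  have h1 := h t ht x
  have h2 : pdx (fun s y => ρ s y * u s y) t x = pdx ρ t x * u t x + ρ t x * pdx u t x :=
    ((nse_hdx (nse_c1 S.hr (t, x))).mul (nse_hdx (nse_c1 S.hu (t, x)))).deriv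
  rw [h2] at h1
  linarith

lemma mom (S : NseSol μp μm γp γm kp km T ρbar c ρ θ u) {t : ℝ} (ht : t ∈ Icc 0 T) (x : ℝ) :
    ρ t x * (pdt u t x + u t x * pdx u t x) = pdx (sigm μp μm γp γm c ρ θ u) t x := by
  have h0 := S.mass ht x
  obtain ⟨-, -, -, -, -, -, h, -⟩ := S.heq
  have h1 := h t ht x
  have h2 : pdx (fun s y => ρ s y * u s y ^ 2) t x
      = pdx ρ t x * u t x ^ 2 + ρ t x * (2 * u t x ^ 1 * pdx u t x) :=
    ((nse_hdx (nse_c1 S.hr (t, x))).mul ((nse_hdx (nse_c1 S.hu (t, x))).fun_pow 2)).deriv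
  have h3 : pdt (fun s y => ρ s y * u s y) t x = pdt ρ t x * u t x + ρ t x * pdt u t x :=
    ((nse_hdt (nse_c1 S.hr (t, x))).mul (nse_hdt (nse_c1 S.hu (t, x)))).deriv
  rw [h2, h3] at h1
  linear_combination h1 - u t x * h0

lemma temp (S : NseSol μp μm γp γm kp km T ρbar c ρ θ u) {t : ℝ} (ht : t ∈ Icc 0 T) (x : ℝ) :
    ρ t x * affc kp km (c t x) * (pdt θ t x + u t x * pdx θ t x)
      = sigm μp μm γp γm c ρ θ u t x * pdx u t x := by
  have h0 := S.mass ht x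
  have hm := S.mom ht x
  obtain ⟨-, -, -, -, hc, -, -, h⟩ := S.heq
  have hc := hc t ht x
  have h1 := h t ht x
  have dρt := nse_hdt (nse_c1 S.hr (t, x))
  have dρx := nse_hdx (nse_c1 S.hr (t, x))
  have dut := nse_hdt (nse_c1 S.hu (t, x))
  have dux := nse_hdx (nse_c1 S.hu (t, x))
  have dθt := nse_hdt (nse_c1 S.hth (t, x))
  have dθx := nse_hdx (nse_c1 S.hth (t, x))
  have dct := nse_affc_hd (a := kp) (b := km) (nse_hdt (nse_c1 S.hc (t, x)))
  have dcx := nse_affc_hd (a := kp) (b := km) (nse_hdx (nse_c1 S.hc (t, x)))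
  have dσx := nse_hdx (nse_c1 S.smooth_sigm (t, x))
  have dEt := ((dut.fun_pow 2).div_const 2).add (dct.mul dθt)
  have dEx := ((dux.fun_pow 2).div_const 2).add (dcx.mul dθx)
  have h2 : pdt (fun s y => ρ s y * Etot kp km c θ u s y) t x = _ := (dρt.mul dEt).deriv
  have h3 : pdx (fun s y => ρ s y * Etot kp km c θ u s y * u s y) t x = _ :=
    ((dρx.mul dEx).mul dux).deriv
  have h4 : pdx (fun s y => sigm μp μm γp γm c ρ θ u s y * u s y) t x = _ :=
    (dσx.mul dux).deriv
  rw [h2, h3, h4] at h1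
  simp only [Pi.add_apply, Pi.mul_apply] at h1
  linear_combination h1 - (u t x ^ 2 / 2 + affc kp km (c t x) * θ t x) * h0
    - u t x * hm - ρ t x * θ t x * (kp - km) * hc

/-- the pressure -/
lemma pres (S : NseSol μp μm γp γm kp km T ρbar c ρ θ u) {t : ℝ} (ht : t ∈ Icc 0 T) (x : ℝ) :
    ∃ pt px : ℝ,
      HasDerivAt (fun s => (affc γp γm (c s x) - 1) * ρ s x * θ s x) pt t ∧
      HasDerivAt (fun y => (affc γp γm (c t y) - 1) * ρ t y * θ t y) px x ∧
      affc kp km (c t x) * (pt + u t x * px) = pdx u t x *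
        ((affc γp γm (c t x) - 1) * sigm μp μm γp γm c ρ θ u t x
        - affc kp km (c t x) * ((affc γp γm (c t x) - 1) * ρ t x * θ t x)) := by
  have h0 := S.mass ht x
  have hθ := S.temp ht x
  obtain ⟨-, -, -, -, hc, -, -, -⟩ := S.heq
  have hc := hc t ht x
  have dρt := nse_hdt (nse_c1 S.hr (t, x))
  have dρx := nse_hdx (nse_c1 S.hr (t, x))
  have dθt := nse_hdt (nse_c1 S.hth (t, x))
  have dθx := nse_hdx (nse_c1 S.hth (t, x))
  have dct := (nse_affc_hd (a := γp) (b := γm) (nse_hdt (nse_c1 S.hc (t, x)))).sub_const 1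
  have dcx := (nse_affc_hd (a := γp) (b := γm) (nse_hdx (nse_c1 S.hc (t, x)))).sub_const 1
  refine ⟨_, _, (dct.fun_mul dρt).fun_mul dθt, (dcx.fun_mul dρx).fun_mul dθx, ?_⟩
  linear_combination (affc γp γm (c t x) - 1) * hθ
    + affc kp km (c t x) * (affc γp γm (c t x) - 1) * θ t x * h0
    + affc kp km (c t x) * ρ t x * θ t x * (γp - γm) * hc

lemma stress (S : NseSol μp μm γp γm kp km T ρbar c ρ θ u) {t : ℝ} (ht : t ∈ Icc 0 T) (x : ℝ) :
    pdt (sigm μp μm γp γm c ρ θ u) t x + u t x * pdx (sigm μp μm γp γm c ρ θ u) t x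
      = affc μp μm (c t x) * ((pdx (pdx (sigm μp μm γp γm c ρ θ u)) t x
        - pdx ρ t x * pdx (sigm μp μm γp γm c ρ θ u) t x / ρ t x) / ρ t x)
        - (1 + (affc γp γm (c t x) - 1) / affc kp km (c t x))
          * sigm μp μm γp γm c ρ θ u t x * pdx u t x := by
  obtain ⟨pt, px, dpt, dpx, hp⟩ := S.pres ht x
  have hr := (S.hpos t ht x).2.1
  have hk := S.k_pos ht x
  have hm := S.mom ht x
  have hc := S.heq.2.2.2.2.1 t ht x
  have dct := nse_affc_hd (a := μp) (b := μm) (nse_hdt (nse_c1 S.hc (t, x)))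
  have dcx := nse_affc_hd (a := μp) (b := μm) (nse_hdx (nse_c1 S.hc (t, x)))
  have duxt := nse_hdt (nse_c1 (nse_smooth_pdx S.hu) (t, x))
  have duxx := nse_hdx (nse_c1 (nse_smooth_pdx S.hu) (t, x))
  have dutx := nse_hdx (nse_c1 (nse_smooth_pdt S.hu) (t, x))
  have dux := nse_hdx (nse_c1 S.hu (t, x))
  have dρx := nse_hdx (nse_c1 S.hr (t, x))
  have hcomm := nse_comm S.hu t x
  have e1 : pdt (sigm μp μm γp γm c ρ θ u) t x = _ := ((dct.fun_mul duxt).fun_sub dpt).deriv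
  have e2 : pdx (sigm μp μm γp γm c ρ θ u) t x = _ := ((dcx.fun_mul duxx).fun_sub dpx).deriv
  have e3 : pdx (pdx (sigm μp μm γp γm c ρ θ u)) t x =
      pdx (fun s y => ρ s y * (pdt u s y + u s y * pdx u s y)) t x := by
    unfold pdx
    congr 1
    ext y
    exact (S.mom ht y).symm
  have e4 : pdx (fun s y => ρ s y * (pdt u s y + u s y * pdx u s y)) t x = _ :=
    (dρx.fun_mul (dutx.fun_add (dux.fun_mul duxx))).deriv
  have e5 : (pdx (pdx (sigm μp μm γp γm c ρ θ u)) t x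
        - pdx ρ t x * pdx (sigm μp μm γp γm c ρ θ u) t x / ρ t x) / ρ t x
      = pdx (pdt u) t x + (pdx u t x * pdx u t x + u t x * pdx (pdx u) t x) := by
    rw [e3, e4, ← hm]
    field_simp
    ring
  have e6 : pt + u t x * px = pdx u t x *
      ((affc γp γm (c t x) - 1) / affc kp km (c t x) * sigm μp μm γp γm c ρ θ u t x
        - ((affc γp γm (c t x) - 1) * ρ t x * θ t x)) := by
    field_simp
    linear_combination hp
  have e7 : sigm μp μm γp γm c ρ θ u t x = affc μp μm (c t x) * pdx u t x
    - (affc γp γm (c t x) - 1) * ρ t x * θ t x := rfl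
  rw [e5]
  rw [e1, e2]
  linear_combination (μp - μm) * pdx u t x * hc + affc μp μm (c t x) * hcomm - e6
    + (pdx u t x) * e7

end NseSol

lemma nse_pdx_per {f : ℝ → ℝ → ℝ} (h : ∀ t x, f t (x + 1) = f t x) (t x : ℝ) :
    pdx f t (x + 1) = pdx f t x := by
  unfold pdx
  rw [← deriv_comp_add_const]
  simp only [h]

namespace NseSol

variable {μp μm γp γm kp km T ρbar : ℝ} {c ρ θ u : ℝ → ℝ → ℝ}

lemma sigm_per (S : NseSol μp μm γp γm kp km T ρbar c ρ θ u) (t x : ℝ) :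
    sigm μp μm γp γm c ρ θ u t (x + 1) = sigm μp μm γp γm c ρ θ u t x := by
  obtain ⟨h1, h2, h3, h4, -⟩ := S.heq
  unfold sigm
  rw [h1, h2, h3, nse_pdx_per h4]

lemma energy (S : NseSol μp μm γp γm kp km T ρbar c ρ θ u) {t : ℝ} (ht : t ∈ Icc 0 T) :
    (∫ x in (0:ℝ)..1, ρ t x * Etot kp km c θ u t x)
      = ∫ x in (0:ℝ)..1, ρ 0 x * Etot kp km c θ u 0 x := by
  have h1 := S.hc
  have h2 := S.hr
  have h3 := S.hth
  have h4 := S.hu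
  have h5 := S.smooth_sigm
  have sE : ContDiff ℝ (⊤ : ℕ∞) (uncurry fun s y => ρ s y * Etot kp km c θ u s y) := by
    have : ContDiff ℝ (⊤ : ℕ∞) (fun z : ℝ × ℝ => uncurry ρ z *
      (uncurry u z ^ 2 / 2 + affc kp km (uncurry c z) * uncurry θ z)) := by
      unfold affc; fun_prop
    exact this
  have sEu : ContDiff ℝ (⊤ : ℕ∞) (uncurry fun s y => ρ s y * Etot kp km c θ u s y * u s y) :=
    sE.mul h4
  have sσu : ContDiff ℝ (⊤ : ℕ∞) (uncurry fun s y => sigm μp μm γp γm c ρ θ u s y * u s y) :=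
    h5.mul h4
  have sF : ContDiff ℝ (⊤ : ℕ∞) (uncurry fun s y => ρ s y * Etot kp km c θ u s y * u s y
      - sigm μp μm γp γm c ρ θ u s y * u s y) := sEu.sub sσu
  have := nse_balance S.hT.le (f := fun s y => ρ s y * Etot kp km c θ u s y)
    (F := fun s y => ρ s y * Etot kp km c θ u s y * u s y
      - sigm μp μm γp γm c ρ θ u s y * u s y) (g := fun _ _ => 0)
    (fun t _ x => nse_c1 sE _) (fun t _ x => nse_c1 sF _) ?_ ?_ t ht
  · simpa using this
  · intro t ht
    have k := S.sigm_per t 0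
    obtain ⟨k1, k2, k3, k4, -⟩ := S.heq
    have k1 := k1 t 0
    have k2 := k2 t 0
    have k3 := k3 t 0
    have k4 := k4 t 0
    simp only [zero_add] at k k1 k2 k3 k4
    simp only [Etot, k, k1, k2, k3, k4]
  · intro t ht x
    have e : pdx (fun s y => ρ s y * Etot kp km c θ u s y * u s y
      - sigm μp μm γp γm c ρ θ u s y * u s y) t x = _ :=
      ((nse_hdx (nse_c1 sEu (t, x))).fun_sub (nse_hdx (nse_c1 sσu (t, x)))).deriv
    rw [e]
    linarith [S.heq.2.2.2.2.2.2.2 t ht x]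

/-- the pressure has a bounded integral -/
lemma pres_int (S : NseSol μp μm γp γm kp km T ρbar c ρ θ u) {t : ℝ} (ht : t ∈ Icc 0 T) :
    (∫ x in (0:ℝ)..1, (affc γp γm (c t x) - 1) * ρ t x * θ t x)
      ≤ (max γp γm - 1) / min kp km * |∫ x in (0:ℝ)..1, ρ 0 x * Etot kp km c θ u 0 x| := by
  have hk : 0 < min kp km := lt_min S.hconst.2.2.2.2.1 S.hconst.2.2.2.2.2
  have hg : 0 < max γp γm - 1 := by
    have := le_max_left γp γm
    linarith [S.hconst.2.2.1]
  refine le_trans ?_ (mul_le_mul_of_nonneg_left (le_abs_self _) (by positivity))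
  rw [← S.energy ht, ← intervalIntegral.integral_const_mul]
  have cc : Continuous (c t) := S.hc.continuous.comp (Continuous.prodMk_right t)
  have cr : Continuous (ρ t) := S.hr.continuous.comp (Continuous.prodMk_right t)
  have ct : Continuous (θ t) := S.hth.continuous.comp (Continuous.prodMk_right t)
  have cu : Continuous (u t) := S.hu.continuous.comp (Continuous.prodMk_right t)
  refine intervalIntegral.integral_mono_on zero_le_one
    (Continuous.intervalIntegrable (by unfold affc; fun_prop) _ _)
    (Continuous.intervalIntegrable (by unfold Etot affc; fun_prop) _ _) ?_
  intro x _
  obtain ⟨hcx, hr, -, hθ⟩ := S.hpos t ht x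
  have b1 := (nse_affc_pos (a := γp) (b := γm) hcx).2
  have b2 := (nse_affc_pos (a := kp) (b := km) hcx).1
  unfold Etot
  rw [div_mul_eq_mul_div, le_div_iff₀ hk]
  have g1 := S.ga_pos ht x
  have : (affc γp γm (c t x) - 1) * min kp km ≤ (max γp γm - 1) * affc kp km (c t x) :=
    mul_le_mul (by linarith) b2 hk.le hg.le
  have h5 := mul_le_mul_of_nonneg_left this (mul_pos hr hθ).le
  have h6 : 0 ≤ (max γp γm - 1) * ρ t x * u t x ^ 2 := by positivity
  nlinarith

lemma entropy (S : NseSol μp μm γp γm kp km T ρbar c ρ θ u) {P : ℝ}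
    (hP : ∀ t ∈ Icc 0 T,
      (∫ x in (0:ℝ)..1, (affc γp γm (c t x) - 1) * ρ t x * θ t x) ≤ P) :
    (∫ s in (0:ℝ)..T, (∫ x in (0:ℝ)..1, |pdx u s x|) ^ 2)
      ≤ (1 + P) ^ 2 /
        ((min γp γm - 1) / (max kp km + (max γp γm - 1)) * min μp μm) := by
  have hmm : 0 < min μp μm := lt_min S.hconst.1 S.hconst.2.1
  have hk : 0 < max kp km := lt_of_lt_of_le S.hconst.2.2.2.2.1 (le_max_left _ _)
  have hg1 : 0 < min γp γm - 1 := by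
    have := lt_min S.hconst.2.2.1 S.hconst.2.2.2.1
    linarith
  have hg2 : 0 < max γp γm - 1 := by
    have := le_max_left γp γm
    linarith [S.hconst.2.2.1]
  set δ := (min γp γm - 1) / (max kp km + (max γp γm - 1)) with hδ
  have hδ0 : 0 < δ := by positivity
  -- notation
  set p : ℝ → ℝ → ℝ := fun t x => (affc γp γm (c t x) - 1) * ρ t x * θ t x with hp
  set σ := sigm μp μm γp γm c ρ θ u with hσ
  set e : ℝ → ℝ := fun r => affc kp km r / (affc kp km r + affc γp γm r - 1) with he
  set f : ℝ → ℝ → ℝ := fun t x => Real.exp (e (c t x) * Real.log (p t x)) with hf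
  set g : ℝ → ℝ → ℝ := fun t x =>
    (1 - e (c t x)) * affc μp μm (c t x) * pdx u t x ^ 2 * (f t x / p t x) with hg
  have h1 := S.hc
  have h2 := S.hr
  have h3 := S.hth
  have h4 := S.hu
  have h5 := nse_smooth_pdx S.hu
  have ppos : ∀ t ∈ Icc (0:ℝ) T, ∀ x, 0 < p t x := by
    intro t ht x
    have := S.ga_pos ht x
    obtain ⟨-, hr, -, hθ⟩ := S.hpos t ht x
    exact mul_pos (mul_pos (by linarith) hr) hθ
  have dpos : ∀ t ∈ Icc (0:ℝ) T, ∀ x, 0 < affc kp km (c t x) + affc γp γm (c t x) - 1 := by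
    intro t ht x
    linarith [S.ga_pos ht x, S.k_pos ht x]
  have sp : ContDiff ℝ (⊤ : ℕ∞) (uncurry p) := by
    have : ContDiff ℝ (⊤ : ℕ∞) (fun z : ℝ × ℝ =>
      (affc γp γm (uncurry c z) - 1) * uncurry ρ z * uncurry θ z) := by
      unfold affc; fun_prop
    exact this
  have se : ∀ t ∈ Icc (0:ℝ) T, ∀ x, ContDiffAt ℝ 1 e (c t x) := by
    intro t ht x
    refine ContDiffAt.div ?_ ?_ (dpos t ht x).ne'
    · unfold affc; fun_prop
    · unfold affc; fun_prop
  have sf : ∀ t ∈ Icc (0:ℝ) T, ∀ x, ContDiffAt ℝ 1 (uncurry f) (t, x) := by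
    intro t ht x
    have k1 : ContDiffAt ℝ 1 (fun z : ℝ × ℝ => e (uncurry c z)) (t, x) :=
      ContDiffAt.comp (t, x) (f := uncurry c) (g := e) (se t ht x) (nse_c1 h1 _)
    have k2 : ContDiffAt ℝ 1 (fun z : ℝ × ℝ => Real.log (uncurry p z)) (t, x) :=
      (nse_c1 sp (t, x)).log (ppos t ht x).ne'
    exact (k1.mul k2).exp
  have sF : ∀ t ∈ Icc (0:ℝ) T, ∀ x, ContDiffAt ℝ 1 (uncurry fun t x => u t x * f t x) (t, x) :=
    fun t ht x => (nse_c1 h4 (t, x)).mul (sf t ht x)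
  have bal := nse_balance S.hT.le (f := f) (F := fun t x => u t x * f t x) (g := g) sf sF ?_ ?_
    T ⟨S.hT.le, le_rfl⟩
  rotate_left
  · intro t ht
    obtain ⟨k1, k2, k3, k4, -⟩ := S.heq
    have k1 := k1 t 0
    have k2 := k2 t 0
    have k3 := k3 t 0
    have k4 := k4 t 0
    simp only [zero_add] at k1 k2 k3 k4
    simp only [hf, hp, k1, k2, k3, k4]
  · intro t ht x
    obtain ⟨pt, px, dpt, dpx, hpd⟩ := S.pres ht x
    have hkx := S.k_pos ht x
    have hpx := ppos t ht x
    have hdx := dpos t ht x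
    have hcx := S.heq.2.2.2.2.1 t ht x
    have de := ((se t ht x).differentiableAt (by simp)).hasDerivAt
    have det := de.comp t (nse_hdt (nse_c1 h1 (t, x)))
    have dex := de.comp x (nse_hdx (nse_c1 h1 (t, x)))
    have dft := (det.mul (dpt.log hpx.ne')).exp
    have dfx := (nse_hdx (nse_c1 h4 (t, x))).mul ((dex.mul (dpx.log hpx.ne')).exp)
    have e1 : pdt f t x = _ := dft.deriv
    have e2 : pdx (fun t x => u t x * f t x) t x = _ := dfx.deriv
    rw [e1, e2]
    simp only [Pi.mul_apply, Function.comp_apply]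
    have e7 : σ t x = affc μp μm (c t x) * pdx u t x - p t x := rfl
    have e6 : pt + u t x * px = pdx u t x *
        ((affc γp γm (c t x) - 1) / affc kp km (c t x) * σ t x - p t x) := by
      field_simp
      linear_combination hpd
    have e8 : e (c t x) * ((affc γp γm (c t x) - 1) / affc kp km (c t x)) = 1 - e (c t x) := by
      simp only [he]
      field_simp
      ring
    change f t x * (deriv e (c t x) * pdt c t x * Real.log (p t x) + e (c t x) * (pt / p t x))
      + (pdx u t x * f t x + u t x * (f t x *
        (deriv e (c t x) * pdx c t x * Real.log (p t x) + e (c t x) * (px / p t x)))) = g t x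
    simp only [hg]
    generalize Real.log (p t x) = lp
    generalize f t x = ff
    generalize deriv e (c t x) = ed at *
    generalize affc γp γm (c t x) = ga at *
    generalize affc kp km (c t x) = ka at *
    generalize (e (c t x)) = ee at *
    have hpx' := hpx.ne'
    generalize p t x = pp at *
    have hpone : pp * (1 / pp) = 1 := by field_simp
    have : ∀ a, a / pp = a * (1 / pp) := fun a => by field_simp
    rw [this pt, this px, this ff]
    linear_combination ff * ed * lp * hcx + ff * ee * (1 / pp) * e6
      + pdx u t x * ff * (1 / pp) * σ t x * e8 + pdx u t x * ff * (1 / pp) * (1 - ee) * e7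
      - pdx u t x * ff * hpone
  -- bounds on the exponent
  have ebd : ∀ t ∈ Icc (0:ℝ) T, ∀ x, 0 ≤ e (c t x) ∧ δ ≤ 1 - e (c t x) := by
    intro t ht x
    have hkx := S.k_pos ht x
    have hdx := dpos t ht x
    have hgx := S.ga_pos ht x
    obtain ⟨hcx, -⟩ := S.hpos t ht x
    have b1 := (nse_affc_pos (a := γp) (b := γm) hcx)
    have b2 := (nse_affc_pos (a := kp) (b := km) hcx)
    refine ⟨by positivity, ?_⟩
    have : 1 - e (c t x) = (affc γp γm (c t x) - 1)
        / (affc kp km (c t x) + affc γp γm (c t x) - 1) := by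
      simp only [he]; field_simp; ring
    rw [this, hδ]
    gcongr
    · linarith
    · linarith
  have fpos : ∀ t x, 0 < f t x := fun t x => Real.exp_pos _
  have expb : ∀ a q : ℝ, 0 ≤ a → a ≤ 1 → 0 < q → Real.exp (a * Real.log q) ≤ 1 + q := by
    intro a q ha ha1 hq
    by_cases h : Real.log q ≤ 0
    · have : Real.exp (a * Real.log q) ≤ 1 := by
        rw [Real.exp_le_one_iff]; exact mul_nonpos_of_nonneg_of_nonpos ha h
      linarith
    · have : Real.exp (a * Real.log q) ≤ Real.exp (Real.log q) := by
        apply Real.exp_le_exp.2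
        nlinarith
      rw [Real.exp_log hq] at this
      linarith
  have fub : ∀ t ∈ Icc (0:ℝ) T, ∀ x, f t x ≤ 1 + p t x := by
    intro t ht x
    obtain ⟨a1, a2⟩ := ebd t ht x
    exact expb _ _ a1 (by linarith) (ppos t ht x)
  have pfub : ∀ t ∈ Icc (0:ℝ) T, ∀ x, p t x / f t x ≤ 1 + p t x := by
    intro t ht x
    obtain ⟨a1, a2⟩ := ebd t ht x
    have : p t x / f t x = Real.exp ((1 - e (c t x)) * Real.log (p t x)) := by
      rw [sub_mul, Real.exp_sub, one_mul, Real.exp_log (ppos t ht x)]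
    rw [this]
    exact expb _ _ (by linarith) (by linarith) (ppos t ht x)
  -- continuity
  have cS : ∀ h : ℝ → ℝ → ℝ, Continuous (uncurry h) → ContinuousOn (uncurry h) (Icc 0 T ×ˢ univ) :=
    fun h hh => hh.continuousOn
  have cf : ContinuousOn (uncurry f) (Icc 0 T ×ˢ univ) :=
    fun z hz => (sf z.1 hz.1 z.2).continuousAt.continuousWithinAt
  have cp : ContinuousOn (uncurry p) (Icc 0 T ×ˢ univ) := sp.continuous.continuousOn
  have cux : ContinuousOn (uncurry (pdx u)) (Icc 0 T ×ˢ univ) := h5.continuous.continuousOn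
  have cfp : ContinuousOn (uncurry fun t x => f t x / p t x) (Icc 0 T ×ˢ univ) :=
    cf.div cp (fun z hz => (ppos z.1 hz.1 z.2).ne')
  have ce : ContinuousOn (uncurry fun t x => e (c t x)) (Icc 0 T ×ˢ univ) := by
    intro z hz
    have : ContinuousAt (fun z : ℝ × ℝ => e (uncurry c z)) z :=
      ContinuousAt.comp (f := uncurry c) (g := e) (se z.1 hz.1 z.2).continuousAt
        h1.continuous.continuousAt
    exact this.continuousWithinAt
  have cm : ContinuousOn (uncurry fun t x => affc μp μm (c t x)) (Icc 0 T ×ˢ univ) := by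
    have : Continuous (fun z : ℝ × ℝ => affc μp μm (uncurry c z)) := by
      have := h1.continuous
      unfold affc; fun_prop
    exact this.continuousOn
  have cq : ContinuousOn (uncurry fun t x => pdx u t x ^ 2 * (f t x / p t x)) (Icc 0 T ×ˢ univ) :=
    (cux.pow 2).mul cfp
  have cg : ContinuousOn (uncurry g) (Icc 0 T ×ˢ univ) :=
    (((continuousOn_const.sub ce).mul cm).mul (cux.pow 2)).mul cfp
  have hT' : (T : ℝ) ∈ Icc (0:ℝ) T := ⟨S.hT.le, le_rfl⟩
  have h0' : (0 : ℝ) ∈ Icc (0:ℝ) T := ⟨le_rfl, S.hT.le⟩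
  have intp1 : ∀ t ∈ Icc (0:ℝ) T, (∫ x in (0:ℝ)..1, (1 + p t x)) ≤ 1 + P := by
    intro t ht
    rw [intervalIntegral.integral_add (Continuous.intervalIntegrable (by fun_prop) _ _)
      ((nse_slice cp ht).intervalIntegrable _ _)]
    have := hP t ht
    simp only [intervalIntegral.integral_const, sub_zero, smul_eq_mul, mul_one]
    linarith
  have hfT : (∫ x in (0:ℝ)..1, f T x) ≤ 1 + P := by
    refine le_trans (intervalIntegral.integral_mono_on zero_le_one
      ((nse_slice cf hT').intervalIntegrable _ _)
      ((continuous_const.add (nse_slice cp hT')).intervalIntegrable _ _)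
      (fun x _ => fub T hT' x)) (intp1 T hT')
  have hf0 : 0 ≤ ∫ x in (0:ℝ)..1, f 0 x :=
    intervalIntegral.integral_nonneg zero_le_one (fun x _ => (fpos 0 x).le)
  have hP0 : 0 ≤ 1 + P := by
    refine le_trans ?_ (intp1 0 h0')
    exact intervalIntegral.integral_nonneg zero_le_one
      (fun x _ => by linarith [ppos 0 h0' x])
  have bq : ∀ s ∈ Icc (0:ℝ) T, (∫ x in (0:ℝ)..1, |pdx u s x|) ^ 2 ≤
      (1 + P) / (δ * min μp μm) * ∫ x in (0:ℝ)..1, g s x := by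
    intro s hs
    have hq : (δ * min μp μm) * (∫ x in (0:ℝ)..1, pdx u s x ^ 2 * (f s x / p s x))
        ≤ ∫ x in (0:ℝ)..1, g s x := by
      rw [← intervalIntegral.integral_const_mul]
      refine intervalIntegral.integral_mono_on zero_le_one
        ((continuous_const.mul (nse_slice cq hs)).intervalIntegrable _ _)
        ((nse_slice cg hs).intervalIntegrable _ _) ?_
      intro x _
      have a1 := (ebd s hs x).2
      have a2 := (nse_affc_pos (a := μp) (b := μm) (S.hpos s hs x).1).1
      have a3 : 0 ≤ pdx u s x ^ 2 * (f s x / p s x) := by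
        have := ppos s hs x
        have := fpos s x
        positivity
      have a4 : δ * min μp μm ≤ (1 - e (c s x)) * affc μp μm (c s x) :=
        mul_le_mul a1 a2 hmm.le (by linarith)
      have := mul_le_mul_of_nonneg_right a4 a3
      simp only [hg]
      linarith
    have cpf : Continuous (fun x => p s x / f s x) :=
      (nse_slice cp hs).div (nse_slice cf hs) (fun x => (fpos s x).ne')
    have hcs := nse_cs (f := fun x => |pdx u s x| * Real.sqrt (f s x / p s x))
      (g := fun x => Real.sqrt (p s x / f s x))
      (((nse_slice cux hs).abs).mul (nse_slice cfp hs).sqrt) cpf.sqrt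
    have e1 : ∀ x, |pdx u s x| * Real.sqrt (f s x / p s x) * Real.sqrt (p s x / f s x)
        = |pdx u s x| := by
      intro x
      have a1 := ppos s hs x
      have a2 := fpos s x
      rw [mul_assoc, ← Real.sqrt_mul (by positivity)]
      have : f s x / p s x * (p s x / f s x) = 1 := by field_simp
      rw [this, Real.sqrt_one, mul_one]
    have e2 : ∀ x, (|pdx u s x| * Real.sqrt (f s x / p s x)) ^ 2
        = pdx u s x ^ 2 * (f s x / p s x) := by
      intro x
      have a1 := ppos s hs x
      have a2 := fpos s x
      rw [mul_pow, sq_abs, Real.sq_sqrt (by positivity)]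
    have e3 : ∀ x, (Real.sqrt (p s x / f s x)) ^ 2 = p s x / f s x := by
      intro x
      have a1 := ppos s hs x
      have a2 := fpos s x
      rw [Real.sq_sqrt (by positivity)]
    simp only [e1, e2, e3] at hcs
    have h7 : (∫ x in (0:ℝ)..1, p s x / f s x) ≤ 1 + P :=
      le_trans (intervalIntegral.integral_mono_on zero_le_one
      (cpf.intervalIntegrable _ _)
      ((continuous_const.add (nse_slice cp hs)).intervalIntegrable _ _)
      (fun x _ => pfub s hs x)) (intp1 s hs)
    have h8 : 0 ≤ ∫ x in (0:ℝ)..1, pdx u s x ^ 2 * (f s x / p s x) := by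
      refine intervalIntegral.integral_nonneg zero_le_one (fun x _ => ?_)
      have := ppos s hs x
      have := fpos s x
      positivity
    have h9 : (∫ x in (0:ℝ)..1, pdx u s x ^ 2 * (f s x / p s x))
        ≤ (∫ x in (0:ℝ)..1, g s x) / (δ * min μp μm) := by
      rw [le_div_iff₀ (by positivity)]; linarith
    calc _ ≤ _ := hcs
      _ ≤ ((∫ x in (0:ℝ)..1, g s x) / (δ * min μp μm)) * (1 + P) := by
        refine mul_le_mul h9 h7 ?_ (h8.trans h9)
        refine intervalIntegral.integral_nonneg zero_le_one (fun x _ => ?_)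
        have := ppos s hs x
        have := fpos s x
        positivity
      _ = _ := by ring
  have cb : Continuous (fun s => ∫ x in (0:ℝ)..1, |pdx u s x|) :=
    intervalIntegral.continuous_parametric_intervalIntegral_of_continuous'
      (f := fun s x => |pdx u s x|) h5.continuous.abs 0 1
  have fin : (∫ s in (0:ℝ)..T, (∫ x in (0:ℝ)..1, |pdx u s x|) ^ 2) ≤
      ∫ s in (0:ℝ)..T, (1 + P) / (δ * min μp μm) * ∫ x in (0:ℝ)..1, g s x := by
    refine intervalIntegral.integral_mono_on S.hT.le
      ((cb.pow 2).intervalIntegrable _ _) ?_ bq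
    refine ContinuousOn.intervalIntegrable ?_
    rw [uIcc_of_le S.hT.le]
    exact continuousOn_const.mul (nse_param_contOn S.hT.le cg)
  rw [intervalIntegral.integral_const_mul] at fin
  refine fin.trans ?_
  have : (∫ s in (0:ℝ)..T, ∫ x in (0:ℝ)..1, g s x) ≤ 1 + P := by linarith
  calc _ ≤ (1 + P) / (δ * min μp μm) * (1 + P) :=
        mul_le_mul_of_nonneg_left this (by positivity)
    _ = _ := by ring

end NseSol

lemma nse_lin {q D N : ℝ → ℝ} (kq : Continuous q) (kD : Continuous D) (kN : Continuous N)
    (a w : ℝ) : (∫ x in (0:ℝ)..1, w * (a * q x - D x - N x)) =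
      w * (a * (∫ x in (0:ℝ)..1, q x) - (∫ x in (0:ℝ)..1, D x) - ∫ x in (0:ℝ)..1, N x) := by
  rw [intervalIntegral.integral_const_mul, intervalIntegral.integral_sub
    (Continuous.intervalIntegrable (by fun_prop) _ _)
    (Continuous.intervalIntegrable (by fun_prop) _ _), intervalIntegral.integral_sub
    (Continuous.intervalIntegrable (by fun_prop) _ _)
    (Continuous.intervalIntegrable (by fun_prop) _ _), intervalIntegral.integral_const_mul]

lemma nse_young {a x y : ℝ} (hx : 0 ≤ x) (hy : 0 ≤ y) (h : a ^ 2 ≤ 4 * x * y) : a ≤ x + y := by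
  refine abs_le_of_sq_le_sq' ?_ (by positivity) |>.2
  nlinarith [sq_nonneg (x - y)]

lemma nse_scal {L M Y b : ℝ} (hL : 0 ≤ L) (hM : 0 ≤ M) (hY : 0 ≤ Y) :
    L * Y * b + M * b ^ 2 * Y ≤ (L + M) * (1 + b ^ 2) * Y := by
  have r1 : b ≤ 1 + b ^ 2 := by nlinarith [sq_nonneg (b - 1), sq_nonneg b]
  have r2 : L * Y * b ≤ L * Y * (1 + b ^ 2) := by gcongr
  have r3 : 0 ≤ M * Y := by positivity
  linear_combination r2 + r3

namespace NseSol

variable {μp μm γp γm kp km T ρbar : ℝ} {c ρ θ u : ℝ → ℝ → ℝ}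

lemma sup_sq (S : NseSol μp μm γp γm kp km T ρbar c ρ θ u) (t : ℝ) :
    ∃ q : ℝ, 0 ≤ q ∧ (∀ x ∈ Icc (0:ℝ) 1, sigm μp μm γp γm c ρ θ u t x ^ 2 ≤
      (∫ y in (0:ℝ)..1, sigm μp μm γp γm c ρ θ u t y ^ 2) + 2 * q) ∧
      q ^ 2 ≤ (∫ y in (0:ℝ)..1, sigm μp μm γp γm c ρ θ u t y ^ 2) *
        ∫ y in (0:ℝ)..1, pdx (sigm μp μm γp γm c ρ θ u) t y ^ 2 := by
  have c1 : Continuous (sigm μp μm γp γm c ρ θ u t) :=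
    S.smooth_sigm.continuous.comp (Continuous.prodMk_right t)
  have c2 : Continuous (pdx (sigm μp μm γp γm c ρ θ u) t) :=
    (nse_smooth_pdx S.smooth_sigm).continuous.comp (Continuous.prodMk_right t)
  refine ⟨_, ?_, fun x hx => nse_sup (fun x => nse_hdx (nse_c1 S.smooth_sigm (t, x))) c2 hx, ?_⟩
  · exact intervalIntegral.integral_nonneg zero_le_one (fun x _ => by positivity)
  · have := nse_cs c1.abs c2.abs
    simpa only [sq_abs] using this

set_option maxHeartbeats 1000000 in
lemma stress_est (S : NseSol μp μm γp γm kp km T ρbar c ρ θ u) {B L K : ℝ}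
    (hB : (∫ s in (0:ℝ)..T, (∫ x in (0:ℝ)..1, |pdx u s x|) ^ 2) ≤ B)
    (hL : L = (1 / 2 + (max γp γm - 1) / min kp km) / min μp μm)
    (hK : K = 2 * max μp μm * (L + 2 * ρbar * L ^ 2)) {t : ℝ} (ht : t ∈ Icc 0 T) :
    Real.exp (-(K * (T + B))) *
      ((∫ x in (0:ℝ)..1, sigm μp μm γp γm c ρ θ u t x ^ 2) / (2 * max μp μm)
      + (∫ s in (0:ℝ)..t, ∫ x in (0:ℝ)..1, pdx (sigm μp μm γp γm c ρ θ u) s x ^ 2) / (2 * ρbar))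
      ≤ (∫ x in (0:ℝ)..1, sigm μp μm γp γm c ρ θ u 0 x ^ 2) / (2 * min μp μm) := by
  have hm1 : 0 < min μp μm := lt_min S.hconst.1 S.hconst.2.1
  have hm2 : 0 < max μp μm := lt_of_lt_of_le S.hconst.1 (le_max_left _ _)
  have hk1 : 0 < min kp km := lt_min S.hconst.2.2.2.2.1 S.hconst.2.2.2.2.2
  have hg2 : 0 < max γp γm - 1 := by
    have := le_max_left γp γm
    linarith [S.hconst.2.2.1]
  have h0' : (0 : ℝ) ∈ Icc (0:ℝ) T := ⟨le_rfl, S.hT.le⟩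
  have hρb : 0 < ρbar := lt_of_lt_of_le (S.hpos 0 h0' 0).2.1 (S.hpos 0 h0' 0).2.2.1
  have hL0 : 0 < L := by rw [hL]; positivity
  have hK0 : 0 < K := by rw [hK]; positivity
  set σ := sigm μp μm γp γm c ρ θ u with hσ
  set b : ℝ → ℝ := fun s => ∫ x in (0:ℝ)..1, |pdx u s x| with hb
  have h1 := S.hc
  have h2 := S.hr
  have h4 := S.hu
  have h5 := nse_smooth_pdx S.hu
  have h6 : ContDiff ℝ (⊤ : ℕ∞) (uncurry σ) := S.smooth_sigm
  have h7 := nse_smooth_pdx h6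
  have cb : Continuous b :=
    intervalIntegral.continuous_parametric_intervalIntegral_of_continuous'
      (f := fun s x => |pdx u s x|) h5.continuous.abs 0 1
  have b0 : ∀ s, 0 ≤ b s := fun s =>
    intervalIntegral.integral_nonneg zero_le_one (fun x _ => abs_nonneg _)
  have ca : Continuous (fun s => K * (1 + b s ^ 2)) := by fun_prop
  set w : ℝ → ℝ := fun s => Real.exp (-∫ r in (0:ℝ)..s, K * (1 + b r ^ 2)) with hw
  have dw : ∀ s, HasDerivAt w (w s * -(K * (1 + b s ^ 2))) s := fun s =>
    ((ca.integral_hasStrictDerivAt 0 s).hasDerivAt.fun_neg).exp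
  have wpos : ∀ s, 0 < w s := fun s => Real.exp_pos _
  have cw : Continuous w := continuous_iff_continuousAt.2 fun s => (dw s).continuousAt
  have sw : ContDiff ℝ 1 w := by
    rw [contDiff_one_iff_deriv]
    refine ⟨fun s => (dw s).differentiableAt, ?_⟩
    have : deriv w = fun s => w s * -(K * (1 + b s ^ 2)) := by
      ext s; exact (dw s).deriv
    rw [this]
    fun_prop
  have w0 : w 0 = 1 := by simp [hw]
  have wlow : ∀ s ∈ Icc (0:ℝ) T, Real.exp (-(K * (T + B))) ≤ w s := by
    intro s hs
    apply Real.exp_le_exp.2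
    have i1 : (∫ r in (0:ℝ)..s, K * (1 + b r ^ 2)) ≤ ∫ r in (0:ℝ)..T, K * (1 + b r ^ 2) := by
      refine intervalIntegral.integral_mono_interval le_rfl hs.1 hs.2 ?_
        (ca.intervalIntegrable _ _)
      exact Filter.Eventually.of_forall fun r => by
        show (0:ℝ) ≤ K * (1 + b r ^ 2)
        positivity
    have i2 : (∫ r in (0:ℝ)..T, K * (1 + b r ^ 2)) = K * (T + ∫ r in (0:ℝ)..T, b r ^ 2) := by
      rw [intervalIntegral.integral_const_mul, intervalIntegral.integral_add
        (Continuous.intervalIntegrable (by fun_prop) _ _)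
        (Continuous.intervalIntegrable (by fun_prop) _ _)]
      simp
    have i3 : K * (T + ∫ r in (0:ℝ)..T, b r ^ 2) ≤ K * (T + B) := by gcongr
    linarith
  -- balance law
  set f : ℝ → ℝ → ℝ := fun s x => w s * (σ s x ^ 2 / (2 * affc μp μm (c s x))) with hf
  set F : ℝ → ℝ → ℝ := fun s x => w s * (u s x * (σ s x ^ 2 / (2 * affc μp μm (c s x)))
    - σ s x * pdx σ s x / ρ s x) with hF
  set κ : ℝ → ℝ → ℝ := fun s x =>
    (1 / 2 + (affc γp γm (c s x) - 1) / affc kp km (c s x)) / affc μp μm (c s x) with hκ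
  set g : ℝ → ℝ → ℝ := fun s x => w s * (-(K * (1 + b s ^ 2)) *
    (σ s x ^ 2 / (2 * affc μp μm (c s x))) - pdx σ s x ^ 2 / ρ s x
      - κ s x * σ s x ^ 2 * pdx u s x) with hg
  have saff : ∀ a a' : ℝ, ∀ z, ContDiffAt ℝ 1 (fun z : ℝ × ℝ => affc a a' (uncurry c z)) z := by
    intro a a' z
    have := nse_c1 h1 z
    unfold affc; fun_prop
  have swz : ∀ z : ℝ × ℝ, ContDiffAt ℝ 1 (fun z : ℝ × ℝ => w z.1) z :=
    fun z => (sw.comp contDiff_fst).contDiffAt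
  have sq : ∀ s ∈ Icc (0:ℝ) T, ∀ x, ContDiffAt ℝ 1
      (fun z : ℝ × ℝ => uncurry σ z ^ 2 / (2 * affc μp μm (uncurry c z))) (s, x) := by
    intro s hs x
    refine ((nse_c1 h6 (s, x)).pow 2).div (contDiffAt_const.mul (saff _ _ _)) ?_
    have := S.mu_pos hs x
    show 2 * affc μp μm (c s x) ≠ 0
    positivity
  have sf : ∀ s ∈ Icc (0:ℝ) T, ∀ x, ContDiffAt ℝ 1 (uncurry f) (s, x) :=
    fun s hs x => (swz (s, x)).mul (sq s hs x)
  have sF : ∀ s ∈ Icc (0:ℝ) T, ∀ x, ContDiffAt ℝ 1 (uncurry F) (s, x) := by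
    intro s hs x
    exact (swz (s, x)).mul (((nse_c1 h4 (s, x)).mul (sq s hs x)).sub
      (((nse_c1 h6 (s, x)).mul (nse_c1 h7 (s, x))).div (nse_c1 h2 (s, x))
        (S.hpos s hs x).2.1.ne'))
  have bal := nse_balance S.hT.le (f := f) (F := F) (g := g) sf sF ?_ ?_ t ht
  rotate_left
  · intro s hs
    have k5 := S.sigm_per s 0
    have k6 := nse_pdx_per S.sigm_per s 0
    obtain ⟨k1, k2, k3, k4, -⟩ := S.heq
    have k1 := k1 s 0
    have k2 := k2 s 0
    have k4 := k4 s 0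
    simp only [zero_add] at k1 k2 k4 k5 k6
    simp only [hF, hσ, k1, k2, k4, k5, k6]
  · intro s hs x
    have hst := S.stress hs x
    have hcx := S.heq.2.2.2.2.1 s hs x
    have hmu := S.mu_pos hs x
    have hkx := S.k_pos hs x
    have hrx := (S.hpos s hs x).2.1
    have hmu2 : 2 * affc μp μm (c s x) ≠ 0 := by positivity
    have dct := (nse_affc_hd (a := μp) (b := μm) (nse_hdt (nse_c1 h1 (s, x)))).const_mul 2
    have dcx := (nse_affc_hd (a := μp) (b := μm) (nse_hdx (nse_c1 h1 (s, x)))).const_mul 2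
    have dσt := nse_hdt (nse_c1 h6 (s, x))
    have dσx := nse_hdx (nse_c1 h6 (s, x))
    have dσxx := nse_hdx (nse_c1 h7 (s, x))
    have dux := nse_hdx (nse_c1 h4 (s, x))
    have dρx := nse_hdx (nse_c1 h2 (s, x))
    have dft := (dw s).fun_mul ((dσt.fun_pow 2).fun_div dct hmu2)
    have dFx := ((dux.fun_mul ((dσx.fun_pow 2).fun_div dcx hmu2)).fun_sub
      ((dσx.fun_mul dσxx).fun_div dρx hrx.ne')).const_mul (w s)
    have e1 : pdt f s x = _ := dft.deriv
    have e2 : pdx F s x = _ := dFx.deriv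
    rw [e1, e2]
    rw [← hσ] at hst
    simp only [hg, hκ]
    have hst' : pdt σ s x = affc μp μm (c s x) * ((pdx (pdx σ) s x
        - pdx ρ s x * pdx σ s x / ρ s x) / ρ s x)
        - (1 + (affc γp γm (c s x) - 1) / affc kp km (c s x)) * σ s x * pdx u s x
        - u s x * pdx σ s x := by linarith
    have hct : pdt c s x = - (u s x * pdx c s x) := by linarith
    rw [hst', hct]
    field_simp
    ring
  -- continuity
  have cσ : ContinuousOn (uncurry σ) (Icc 0 T ×ˢ univ) := h6.continuous.continuousOn
  have cσx : ContinuousOn (uncurry (pdx σ)) (Icc 0 T ×ˢ univ) := h7.continuous.continuousOn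
  have cux : ContinuousOn (uncurry (pdx u)) (Icc 0 T ×ˢ univ) := h5.continuous.continuousOn
  have cr : ContinuousOn (uncurry ρ) (Icc 0 T ×ˢ univ) := h2.continuous.continuousOn
  have caff : ∀ a a' : ℝ, ContinuousOn (uncurry fun s x => affc a a' (c s x))
      (Icc 0 T ×ˢ univ) := fun a a' z _ => (saff a a' z).continuousAt.continuousWithinAt
  have cq : ContinuousOn (uncurry fun s x => σ s x ^ 2 / (2 * affc μp μm (c s x)))
      (Icc 0 T ×ˢ univ) := fun z hz => (sq z.1 hz.1 z.2).continuousAt.continuousWithinAt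
  have cκ : ContinuousOn (uncurry κ) (Icc 0 T ×ˢ univ) :=
    (continuousOn_const.add (((caff γp γm).sub continuousOn_const).div (caff kp km)
      (fun z hz => (S.k_pos hz.1 z.2).ne'))).div (caff μp μm)
      (fun z hz => (S.mu_pos hz.1 z.2).ne')
  have cD : ContinuousOn (uncurry fun s x => pdx σ s x ^ 2 / ρ s x) (Icc 0 T ×ˢ univ) :=
    (cσx.pow 2).div cr (fun z hz => (S.hpos z.1 hz.1 z.2).2.1.ne')
  have cN : ContinuousOn (uncurry fun s x => κ s x * σ s x ^ 2 * pdx u s x) (Icc 0 T ×ˢ univ) :=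
    (cκ.mul (cσ.pow 2)).mul cux
  have cwz : ContinuousOn (fun z : ℝ × ℝ => w z.1) (Icc 0 T ×ˢ univ) :=
    (cw.comp continuous_fst).continuousOn
  have caz : ContinuousOn (fun z : ℝ × ℝ => -(K * (1 + b z.1 ^ 2))) (Icc 0 T ×ˢ univ) :=
    (ca.neg.comp continuous_fst).continuousOn
  have cg : ContinuousOn (uncurry g) (Icc 0 T ×ˢ univ) :=
    cwz.mul (((caz.mul cq).sub cD).sub cN)
  -- the key differential inequality
  have key : ∀ s ∈ Icc (0:ℝ) T, (∫ x in (0:ℝ)..1, g s x) ≤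
      -(Real.exp (-(K * (T + B))) / (2 * ρbar)) * ∫ x in (0:ℝ)..1, pdx σ s x ^ 2 := by
    intro s hs
    have i1 : (∫ x in (0:ℝ)..1, g s x) = w s * (-(K * (1 + b s ^ 2)) *
        (∫ x in (0:ℝ)..1, σ s x ^ 2 / (2 * affc μp μm (c s x)))
        - (∫ x in (0:ℝ)..1, pdx σ s x ^ 2 / ρ s x)
        - ∫ x in (0:ℝ)..1, κ s x * σ s x ^ 2 * pdx u s x) := by
      exact nse_lin (nse_slice cq hs) (nse_slice cD hs) (nse_slice cN hs) _ _
    obtain ⟨q, q0, hq1, hq2⟩ := S.sup_sq s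
    rw [← hσ] at hq1 hq2
    set Y := ∫ x in (0:ℝ)..1, σ s x ^ 2 with hY
    set Z := ∫ x in (0:ℝ)..1, pdx σ s x ^ 2 with hZ
    have Y0 : 0 ≤ Y := intervalIntegral.integral_nonneg zero_le_one (fun x _ => sq_nonneg _)
    have Z0 : 0 ≤ Z := intervalIntegral.integral_nonneg zero_le_one (fun x _ => sq_nonneg _)
    have i2 : Y / (2 * max μp μm) ≤ ∫ x in (0:ℝ)..1, σ s x ^ 2 / (2 * affc μp μm (c s x)) := by
      rw [hY, ← intervalIntegral.integral_div]
      refine intervalIntegral.integral_mono_on zero_le_one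
        ((((nse_slice cσ hs).pow 2).div_const _).intervalIntegrable _ _)
        ((nse_slice cq hs).intervalIntegrable _ _) ?_
      intro x _
      have := S.mu_pos hs x
      have := (nse_affc_pos (a := μp) (b := μm) (S.hpos s hs x).1).2
      gcongr
    have i3 : Z / ρbar ≤ ∫ x in (0:ℝ)..1, pdx σ s x ^ 2 / ρ s x := by
      rw [hZ, ← intervalIntegral.integral_div]
      refine intervalIntegral.integral_mono_on zero_le_one
        ((((nse_slice cσx hs).pow 2).div_const _).intervalIntegrable _ _)
        ((nse_slice cD hs).intervalIntegrable _ _) ?_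
      intro x _
      obtain ⟨-, a1, a2, -⟩ := S.hpos s hs x
      gcongr
    have i4 : -(∫ x in (0:ℝ)..1, κ s x * σ s x ^ 2 * pdx u s x) ≤ L * (Y + 2 * q) * b s := by
      rw [hb, ← intervalIntegral.integral_const_mul, ← intervalIntegral.integral_neg]
      refine intervalIntegral.integral_mono_on zero_le_one
        ((nse_slice cN hs).neg.intervalIntegrable _ _)
        ((continuous_const.mul (nse_slice cux hs).abs).intervalIntegrable _ _) ?_
      intro x hx
      have a1 := S.mu_pos hs x
      have a2 := S.k_pos hs x
      have a3 := S.ga_pos hs x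
      have hcx := (S.hpos s hs x).1
      have a4 := (nse_affc_pos (a := μp) (b := μm) hcx).1
      have a5 := (nse_affc_pos (a := kp) (b := km) hcx).1
      have a6 := (nse_affc_pos (a := γp) (b := γm) hcx).2
      have κ0 : 0 ≤ κ s x := by
        have : 0 < affc γp γm (c s x) - 1 := by linarith
        simp only [hκ]
        positivity
      have κL : κ s x ≤ L := by
        have : 0 < affc γp γm (c s x) - 1 := by linarith
        rw [hL]
        simp only [hκ]
        gcongr
      have a7 : κ s x * σ s x ^ 2 ≤ L * (Y + 2 * q) :=
        mul_le_mul κL (hq1 x hx) (sq_nonneg _) hL0.le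
      have a8 : -pdx u s x ≤ |pdx u s x| := neg_le_abs _
      calc -(κ s x * σ s x ^ 2 * pdx u s x) = κ s x * σ s x ^ 2 * (-pdx u s x) := by ring
        _ ≤ κ s x * σ s x ^ 2 * |pdx u s x| :=
          mul_le_mul_of_nonneg_left a8 (by positivity)
        _ ≤ _ := mul_le_mul_of_nonneg_right a7 (abs_nonneg _)
    -- Young
    have i5 : 2 * L * q * b s ≤ Z / (2 * ρbar) + 2 * ρbar * L ^ 2 * b s ^ 2 * Y := by
      have r0 : 0 ≤ Z / (2 * ρbar) := by positivity
      have r1 : 0 ≤ 2 * ρbar * L ^ 2 * b s ^ 2 * Y := by positivity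
      have r2 : (2 * L * q * b s) ^ 2 ≤ 4 * (Z / (2 * ρbar)) * (2 * ρbar * L ^ 2 * b s ^ 2 * Y) := by
        have : 4 * (Z / (2 * ρbar)) * (2 * ρbar * L ^ 2 * b s ^ 2 * Y)
          = 4 * L ^ 2 * b s ^ 2 * (Y * Z) := by field_simp
        rw [this]
        have := mul_le_mul_of_nonneg_left hq2 (show 0 ≤ 4 * L ^ 2 * b s ^ 2 by positivity)
        linarith
      exact nse_young r0 r1 r2
    have i6 : L * Y * b s + 2 * ρbar * L ^ 2 * b s ^ 2 * Y ≤
        K * (1 + b s ^ 2) * (Y / (2 * max μp μm)) := by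
      have : K * (1 + b s ^ 2) * (Y / (2 * max μp μm))
        = (L + 2 * ρbar * L ^ 2) * (1 + b s ^ 2) * Y := by
        rw [hK]; field_simp
      rw [this]
      exact nse_scal hL0.le (by positivity) Y0
    have i7 : K * (1 + b s ^ 2) * (Y / (2 * max μp μm)) ≤ K * (1 + b s ^ 2) *
        ∫ x in (0:ℝ)..1, σ s x ^ 2 / (2 * affc μp μm (c s x)) :=
      mul_le_mul_of_nonneg_left i2 (by positivity)
    have i8 : -(K * (1 + b s ^ 2)) *
        (∫ x in (0:ℝ)..1, σ s x ^ 2 / (2 * affc μp μm (c s x)))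
        - (∫ x in (0:ℝ)..1, pdx σ s x ^ 2 / ρ s x)
        - (∫ x in (0:ℝ)..1, κ s x * σ s x ^ 2 * pdx u s x) ≤ -(Z / (2 * ρbar)) := by
      have : Z / ρbar = Z / (2 * ρbar) + Z / (2 * ρbar) := by field_simp; ring
      linarith
    rw [i1]
    have r := wlow s hs
    have i9 := mul_le_mul_of_nonneg_left i8 (wpos s).le
    have i10 := mul_le_mul_of_nonneg_right r (show 0 ≤ Z / (2 * ρbar) by positivity)
    have i11 : -(Real.exp (-(K * (T + B))) / (2 * ρbar)) * Z
      = -(Real.exp (-(K * (T + B))) * (Z / (2 * ρbar))) := by ring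
    rw [i11]
    linarith
  have hsub : Icc (0:ℝ) t ⊆ Icc 0 T := Icc_subset_Icc le_rfl ht.2
  have cZ := nse_param_contOn S.hT.le (h := fun s x => pdx σ s x ^ 2) (cσx.fun_pow 2)
  have fin : (∫ s in (0:ℝ)..t, ∫ x in (0:ℝ)..1, g s x) ≤
      ∫ s in (0:ℝ)..t, -(Real.exp (-(K * (T + B))) / (2 * ρbar)) *
        ∫ x in (0:ℝ)..1, pdx σ s x ^ 2 := by
    refine intervalIntegral.integral_mono_on ht.1 ?_ ?_ (fun s hs => key s (hsub hs))
    · refine ContinuousOn.intervalIntegrable ?_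
      rw [uIcc_of_le ht.1]
      exact (nse_param_contOn S.hT.le cg).mono hsub
    · refine ContinuousOn.intervalIntegrable ?_
      rw [uIcc_of_le ht.1]
      exact continuousOn_const.mul (cZ.mono hsub)
  rw [intervalIntegral.integral_const_mul] at fin
  have j1 : (∫ x in (0:ℝ)..1, f 0 x) ≤ (∫ x in (0:ℝ)..1, σ 0 x ^ 2) / (2 * min μp μm) := by
    simp only [hf, w0, one_mul]
    rw [← intervalIntegral.integral_div]
    refine intervalIntegral.integral_mono_on zero_le_one
      ((nse_slice cq h0').intervalIntegrable _ _)
      ((((nse_slice cσ h0').pow 2).div_const _).intervalIntegrable _ _) ?_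
    intro x _
    have := (nse_affc_pos (a := μp) (b := μm) (S.hpos 0 h0' x).1).1
    gcongr
  have j2 : Real.exp (-(K * (T + B))) * ((∫ x in (0:ℝ)..1, σ t x ^ 2) / (2 * max μp μm))
      ≤ ∫ x in (0:ℝ)..1, f t x := by
    simp only [hf]
    rw [intervalIntegral.integral_const_mul]
    refine mul_le_mul (wlow t ht) ?_ ?_ (wpos t).le
    · rw [← intervalIntegral.integral_div]
      refine intervalIntegral.integral_mono_on zero_le_one
        ((((nse_slice cσ ht).pow 2).div_const _).intervalIntegrable _ _)
        ((nse_slice cq ht).intervalIntegrable _ _) ?_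
      intro x _
      have := S.mu_pos ht x
      have := (nse_affc_pos (a := μp) (b := μm) (S.hpos t ht x).1).2
      gcongr
    · have : 0 ≤ ∫ x in (0:ℝ)..1, σ t x ^ 2 :=
        intervalIntegral.integral_nonneg zero_le_one (fun x _ => sq_nonneg _)
      positivity
  rw [mul_add]
  have j3 : Real.exp (-(K * (T + B))) *
      ((∫ s in (0:ℝ)..t, ∫ x in (0:ℝ)..1, pdx σ s x ^ 2) / (2 * ρbar))
      = Real.exp (-(K * (T + B))) / (2 * ρbar) *
        (∫ s in (0:ℝ)..t, ∫ x in (0:ℝ)..1, pdx σ s x ^ 2) := by ring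
  rw [j3]
  linarith

end NseSol

/-- A priori estimate for the Cauchy stress: there are constants
`C₅, C₆ > 0` depending only on the physical constants, `ρ̄`, `T`, the initial total
mass and energy, and the `L²` norm of `σ(0,·)`, such that every smooth 1-periodic
solution of the mesoscopic system with `0 ≤ c ≤ 1`, `0 < ρ ≤ ρ̄`, `θ > 0`, satisfies
`∫₀¹σ(t)² + ∫₀ᵗ∫₀¹(∂ₓσ)² ≤ C₅` for all `t ∈ [0,T]` and `∫₀ᵀ‖σ(t)‖_{L^∞(0,1)}² ≤ C₆`. -/
theorem stmt10 (μp μm γp γm kp km T ρbar M0 E0 S0 : ℝ)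
    (hconst : GoodConsts μp μm γp γm kp km) (hT : 0 < T) (hρbar : 0 < ρbar) :
    ∃ C5 > (0:ℝ), ∃ C6 > (0:ℝ), ∀ c ρ θ u : ℝ → ℝ → ℝ,
      ContDiff ℝ (⊤ : ℕ∞) (uncurry c) → ContDiff ℝ (⊤ : ℕ∞) (uncurry ρ) →
      ContDiff ℝ (⊤ : ℕ∞) (uncurry θ) → ContDiff ℝ (⊤ : ℕ∞) (uncurry u) →
      (∀ t ∈ Icc (0:ℝ) T, ∀ x : ℝ,
        c t x ∈ Icc (0:ℝ) 1 ∧ 0 < ρ t x ∧ ρ t x ≤ ρbar ∧ 0 < θ t x) →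
      MesoEqns μp μm γp γm kp km T c ρ θ u →
      (∫ x in (0:ℝ)..1, ρ 0 x) = M0 →
      (∫ x in (0:ℝ)..1, ρ 0 x * Etot kp km c θ u 0 x) = E0 →
      (∫ x in (0:ℝ)..1, (sigm μp μm γp γm c ρ θ u 0 x) ^ 2) = S0 →
      (∀ t ∈ Icc (0:ℝ) T,
        (∫ x in (0:ℝ)..1, (sigm μp μm γp γm c ρ θ u t x) ^ 2)
          + (∫ s in (0:ℝ)..t, ∫ x in (0:ℝ)..1,
              (pdx (sigm μp μm γp γm c ρ θ u) s x) ^ 2) ≤ C5)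
      ∧ (∫ t in (0:ℝ)..T,
          (⨆ x : Icc (0:ℝ) 1, |sigm μp μm γp γm c ρ θ u t x.1|) ^ 2) ≤ C6 := by
  obtain ⟨hμp, hμm, hγp, hγm, hkp, hkm⟩ := id hconst
  have hm1 : 0 < min μp μm := lt_min hμp hμm
  have hm2 : 0 < max μp μm := lt_of_lt_of_le hμp (le_max_left _ _)
  obtain ⟨P, hP⟩ : ∃ P : ℝ, P = (max γp γm - 1) / min kp km * |E0| := ⟨_, rfl⟩
  obtain ⟨B, hB⟩ : ∃ B : ℝ, B = (1 + P) ^ 2 /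
        ((min γp γm - 1) / (max kp km + (max γp γm - 1)) * min μp μm) := ⟨_, rfl⟩
  obtain ⟨L, hL⟩ : ∃ L : ℝ, L = (1 / 2 + (max γp γm - 1) / min kp km) / min μp μm := ⟨_, rfl⟩
  obtain ⟨K, hK⟩ : ∃ K : ℝ, K = 2 * max μp μm * (L + 2 * ρbar * L ^ 2) := ⟨_, rfl⟩
  obtain ⟨C, hC⟩ : ∃ C : ℝ, C = (2 * max μp μm + 2 * ρbar) *
    (|S0| / (2 * min μp μm) / Real.exp (-(K * (T + B)))) + 1 := ⟨_, rfl⟩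
  have hC0 : 0 < C := by rw [hC]; positivity
  refine ⟨C, hC0, 2 * T * C + C, by positivity, ?_⟩
  intro c ρ θ u hc hr hth hu hpos heq _ hE0 hS0
  have S : NseSol μp μm γp γm kp km T ρbar c ρ θ u := ⟨hconst, hT, hc, hr, hth, hu, hpos, heq⟩
  have hPb : ∀ t ∈ Icc 0 T,
      (∫ x in (0:ℝ)..1, (affc γp γm (c t x) - 1) * ρ t x * θ t x) ≤ P := by
    intro t ht
    have := S.pres_int ht
    rwa [hE0, ← hP] at this
  have hBb := S.entropy hPb
  rw [← hB] at hBb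
  have hσs := S.smooth_sigm
  have hσxs := nse_smooth_pdx hσs
  set σ := sigm μp μm γp γm c ρ θ u with hσ
  have main : ∀ t ∈ Icc (0:ℝ) T, (∫ x in (0:ℝ)..1, σ t x ^ 2)
      + (∫ s in (0:ℝ)..t, ∫ x in (0:ℝ)..1, pdx σ s x ^ 2) ≤ C := by
    intro t ht
    have h := S.stress_est hBb hL hK ht
    rw [← hσ, hS0] at h
    set Y := ∫ x in (0:ℝ)..1, σ t x ^ 2 with hY
    set Z := ∫ s in (0:ℝ)..t, ∫ x in (0:ℝ)..1, pdx σ s x ^ 2 with hZ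
    have Y0 : 0 ≤ Y := intervalIntegral.integral_nonneg zero_le_one (fun x _ => sq_nonneg _)
    have Z0 : 0 ≤ Z := intervalIntegral.integral_nonneg ht.1 (fun s _ =>
      intervalIntegral.integral_nonneg zero_le_one (fun x _ => sq_nonneg _))
    have h2 : Y / (2 * max μp μm) + Z / (2 * ρbar) ≤
        |S0| / (2 * min μp μm) / Real.exp (-(K * (T + B))) := by
      rw [le_div_iff₀ (Real.exp_pos _), mul_comm]
      refine h.trans ?_
      gcongr
      exact le_abs_self _
    have h3 : Y + Z ≤ (2 * max μp μm + 2 * ρbar) * (Y / (2 * max μp μm) + Z / (2 * ρbar)) := by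
      have e1 : (2 * max μp μm + 2 * ρbar) * (Y / (2 * max μp μm) + Z / (2 * ρbar))
        = Y + Z + (2 * ρbar) * (Y / (2 * max μp μm)) + (2 * max μp μm) * (Z / (2 * ρbar)) := by
        field_simp
        ring
      rw [e1]
      have : 0 ≤ (2 * ρbar) * (Y / (2 * max μp μm)) := by positivity
      have : 0 ≤ (2 * max μp μm) * (Z / (2 * ρbar)) := by positivity
      linarith
    have h4 := mul_le_mul_of_nonneg_left h2
      (show 0 ≤ 2 * max μp μm + 2 * ρbar by positivity)
    linarith
  refine ⟨main, ?_⟩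
  have cZ : Continuous (fun s => ∫ x in (0:ℝ)..1, pdx σ s x ^ 2) :=
    intervalIntegral.continuous_parametric_intervalIntegral_of_continuous'
      (f := fun s x => pdx σ s x ^ 2) (by exact hσxs.continuous.fun_pow 2) 0 1
  have Z0 : ∀ t ∈ Icc (0:ℝ) T, 0 ≤ ∫ s in (0:ℝ)..t, ∫ x in (0:ℝ)..1, pdx σ s x ^ 2 :=
    fun t ht => intervalIntegral.integral_nonneg ht.1 (fun s _ =>
      intervalIntegral.integral_nonneg zero_le_one (fun x _ => sq_nonneg _))
  have sup : ∀ t ∈ Icc (0:ℝ) T, (⨆ x : Icc (0:ℝ) 1, |σ t x.1|) ^ 2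
      ≤ 2 * C + ∫ x in (0:ℝ)..1, pdx σ t x ^ 2 := by
    intro t ht
    obtain ⟨q, q0, hq1, hq2⟩ := S.sup_sq t
    rw [← hσ] at hq1 hq2
    have hm := main t ht
    have hz := Z0 t ht
    set Y := ∫ x in (0:ℝ)..1, σ t x ^ 2 with hY
    set Z := ∫ x in (0:ℝ)..1, pdx σ t x ^ 2 with hZ
    have Y0 : 0 ≤ Y := intervalIntegral.integral_nonneg zero_le_one (fun x _ => sq_nonneg _)
    have Zn : 0 ≤ Z := intervalIntegral.integral_nonneg zero_le_one (fun x _ => sq_nonneg _)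
    have h1 : 2 * q ≤ Y + Z := by
      refine abs_le_of_sq_le_sq' ?_ (by positivity) |>.2
      nlinarith [sq_nonneg (Y - Z)]
    have h2 : (⨆ x : Icc (0:ℝ) 1, |σ t x.1|) ≤ Real.sqrt (2 * C + Z) := by
      have : Nonempty (Icc (0:ℝ) 1) := ⟨⟨0, by simp⟩⟩
      refine ciSup_le fun x => ?_
      refine Real.le_sqrt_of_sq_le ?_
      rw [sq_abs]
      have := hq1 x.1 x.2
      linarith
    have h3 : 0 ≤ ⨆ x : Icc (0:ℝ) 1, |σ t x.1| := Real.iSup_nonneg fun x => abs_nonneg _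
    calc _ ≤ Real.sqrt (2 * C + Z) ^ 2 := by gcongr
      _ = _ := Real.sq_sqrt (by positivity)
  have ci : Continuous (fun t => 2 * C + ∫ x in (0:ℝ)..1, pdx σ t x ^ 2) :=
    continuous_const.add cZ
  have le : (∫ t in (0:ℝ)..T, (⨆ x : Icc (0:ℝ) 1, |σ t x.1|) ^ 2)
      ≤ ∫ t in (0:ℝ)..T, (2 * C + ∫ x in (0:ℝ)..1, pdx σ t x ^ 2) := by
    rw [intervalIntegral.integral_of_le hT.le, intervalIntegral.integral_of_le hT.le]
    refine integral_mono_of_nonneg (Filter.Eventually.of_forall fun t => sq_nonneg _) ?_ ?_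
    · exact ci.integrableOn_Icc.mono_set Ioc_subset_Icc_self
    · refine (ae_restrict_iff' measurableSet_Ioc).2 (Filter.Eventually.of_forall fun t ht => ?_)
      exact sup t ⟨ht.1.le, ht.2⟩
  refine le.trans ?_
  rw [intervalIntegral.integral_add (continuous_const.intervalIntegrable _ _)
    (cZ.intervalIntegrable _ _)]
  have hTm := main T ⟨hT.le, le_rfl⟩
  have Y0 : 0 ≤ ∫ x in (0:ℝ)..1, σ T x ^ 2 :=
    intervalIntegral.integral_nonneg zero_le_one (fun x _ => sq_nonneg _)
  simp only [intervalIntegral.integral_const, sub_zero, smul_eq_mul]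
  linarith
end
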